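/- arXiv:2112.09798 — 5 statements merged into one kernel-verified Lean document; each statement's English description precedes it below -/
import Mathlib

section
/- Let N ≥ 1, let K be a field and q ∈ K a nonzero element. The generalized q-Whittaker difference operators of type A_{N−1}^{(1)} satisfy the quantum Q-system exchange relation: for every a ∈ {1,…,N} and every k ∈ ℤ, q^a · (D_{a;k+1} ∘ D_{a;k−1}) = D_{a;k} ∘ D_{a;k} − D_{a−1;k} ∘ D_{a+1;k}, as K-linear endomorphisms of the rational function field F = K(x_1,…,x_N), where by convention D_{0;k} = id_F and D_{N+1;k} = 0. -/
open scoped BigOperators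

noncomputable section

/-- The rational function field `K(x_1, …, x_N)`, realized as the fraction field of the
polynomial ring in `N` variables over `K`. -/
abbrev RatFun (N : ℕ) (K : Type*) [Field K] : Type _ :=
  FractionRing (MvPolynomial (Fin N) K)

/-- The generator `x_i` of `K(x_1, …, x_N)`. -/
noncomputable def Xvar (N : ℕ) (K : Type*) [Field K] (i : Fin N) : RatFun N K :=
  algebraMap (MvPolynomial (Fin N) K) (RatFun N K) (MvPolynomial.X i)

/-- The generalized q-Whittaker (Macdonald) difference operator `D_{a;k}` of type
`A_{N-1}^{(1)}`, acting on `f ∈ K(x_1, …, x_N)`: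
`D_{a;k} f = ∑_{|I| = a} (∏_{i∈I} x_i^k) (∏_{i∈I} ∏_{j∉I} x_i/(x_i - x_j)) Γ_I f`,
where `Γ I` is the `K`-algebra automorphism multiplying `x_j` by `q` for `j ∈ I`.
By convention `D_{0;k} = id` (and for `a = N+1` the sum is empty, so `D_{N+1;k} = 0`). -/
noncomputable def Dwhittaker {N : ℕ} {K : Type*} [Field K]
    (Γ : Finset (Fin N) → (RatFun N K ≃ₐ[K] RatFun N K)) (a : ℕ) (k : ℤ)
    (f : RatFun N K) : RatFun N K :=
  if a = 0 then f
  else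
    ∑ I ∈ Finset.powersetCard a (Finset.univ : Finset (Fin N)),
      ((∏ i ∈ I, Xvar N K i ^ k) *
          ∏ i ∈ I, ∏ j ∈ Finset.univ \ I, Xvar N K i / (Xvar N K i - Xvar N K j)) *
        Γ I f


namespace QSys

open Polynomial in
/-- Lagrange interpolation evaluated at zero. -/
lemma lagrange_zero {ι F : Type*} [DecidableEq ι] [Field F] (P Q : Finset ι) (u b : ι → F)
    (hu : Set.InjOn u P) (hc : Q.card = P.card) :
    ∏ s ∈ Q, (0 - b s) - ∏ p ∈ P, (0 - u p) =
      ∑ p ∈ P, (∏ s ∈ Q, (u p - b s)) * ∏ j ∈ P.erase p, (0 - u j) / (u p - u j) := by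
  have hdeg : (Lagrange.nodal Q b - Lagrange.nodal P u).degree < P.card := by
    have := Polynomial.degree_sub_lt_left (p := Lagrange.nodal Q b) (q := Lagrange.nodal P u)
      (by simp [Lagrange.degree_nodal, hc]) Lagrange.nodal_ne_zero
      (by rw [Lagrange.nodal_monic.leadingCoeff, Lagrange.nodal_monic.leadingCoeff])
    rwa [Lagrange.degree_nodal, hc] at this
  have h := congrArg (Polynomial.eval 0) (Lagrange.eq_interpolate hu hdeg)
  rw [Lagrange.interpolate_eq_sum] at h
  simp only [eval_sub, Lagrange.eval_nodal, eval_finsetSum, eval_mul, eval_C, eval_prod, eval_X] at h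
  rw [h]
  refine Finset.sum_congr rfl fun p hp => ?_
  rw [Finset.prod_eq_zero (i := p) hp (sub_self _), sub_zero, Finset.prod_div_distrib]
  ring

lemma sum_one {ι F : Type*} [DecidableEq ι] [Field F] (P Q : Finset ι) (x : ι → F) (t : F)
    (ht : t ≠ 0) (hx : ∀ i, x i ≠ 0) (hinj : Function.Injective x) (hc : Q.card = P.card) :
    1 - (∏ p ∈ P, (t * x p)) * ∏ s ∈ Q, (x s)⁻¹ =
      ∑ p ∈ P, (∏ s ∈ Q, (1 - t * x p / x s)) * ∏ j ∈ P.erase p, x j / (x j - x p) := by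
  have h := lagrange_zero P Q x (fun s => x s / t) hinj.injOn hc
  have hQ : ∏ s ∈ Q, (0 - x s / t) ≠ 0 :=
    Finset.prod_ne_zero_iff.2 fun s _ => by simp [hx s, ht]
  have e1 : ∏ p ∈ P, (0 - x p) =
      (∏ s ∈ Q, (0 - x s / t)) * ((∏ p ∈ P, (t * x p)) * ∏ s ∈ Q, (x s)⁻¹) := by
    have : (∏ s ∈ Q, (0 - x s / t)) * ∏ s ∈ Q, (x s)⁻¹ = ∏ p ∈ P, (-t⁻¹) := by
      rw [← Finset.prod_mul_distrib, Finset.prod_const, ← hc, ← Finset.prod_const]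
      refine Finset.prod_congr rfl fun s _ => ?_
      have := hx s
      field_simp
      try ring
    rw [mul_left_comm, this, ← Finset.prod_mul_distrib]
    refine Finset.prod_congr rfl fun s _ => ?_
    field_simp
    try ring
  apply mul_left_cancel₀ hQ
  rw [mul_sub, mul_one, ← e1, h, Finset.mul_sum]
  refine Finset.sum_congr rfl fun p hp => ?_
  rw [← mul_assoc, ← Finset.prod_mul_distrib]
  congr 1
  · refine Finset.prod_congr rfl fun s _ => ?_
    have := hx s
    field_simp
    try ring
  · refine Finset.prod_congr rfl fun j _ => ?_
    rw [← neg_sub (x j) (x p), zero_sub, neg_div_neg_eq]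

open Polynomial in
lemma sum_two {ι F : Type*} [DecidableEq ι] [Field F] (P Q : Finset ι) (x : ι → F) (t : F)
    (hx : ∀ i, x i ≠ 0) (hinj : Function.Injective x) (hc : Q.card = P.card + 2) :
    1 = ∑ p ∈ Q, (∏ j ∈ P, (1 - t * x j / x p)) * ∏ s ∈ Q.erase p, x p / (x p - x s) := by
  have hd : (X * Lagrange.nodal P (fun j => t * x j)).degree = ((P.card + 1 : ℕ) : WithBot ℕ) := by
    rw [degree_mul, degree_X, Lagrange.degree_nodal]; push_cast; ring
  have h := Lagrange.leadingCoeff_eq_sum (s := Q) (v := x) hinj.injOn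
    (P := X * Lagrange.nodal P (fun j => t * x j)) (by rw [hd, hc]; norm_cast)
  rw [leadingCoeff_mul, leadingCoeff_X, Lagrange.nodal_monic.leadingCoeff, one_mul] at h
  refine h.trans ?_
  refine Finset.sum_congr rfl fun p hp => ?_
  rw [eval_mul, eval_X, Lagrange.eval_nodal, Finset.prod_div_distrib, ← mul_div_assoc]
  congr 1
  have hx' := hx p
  rw [Finset.prod_const, Finset.card_erase_of_mem hp, hc, show P.card + 2 - 1 = P.card + 1 by omega,
    pow_succ, ← mul_assoc, ← Finset.prod_const, ← Finset.prod_mul_distrib, mul_comm]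
  congr 1
  refine Finset.prod_congr rfl fun j _ => ?_
  field_simp

/-- Scaling factor. -/
def gam {ι F : Type*} [DecidableEq ι] [Field F] (t : F) (I : Finset ι) (i : ι) : F :=
  if i ∈ I then t else 1

/-- Pair weight. -/
def pw {ι F : Type*} [DecidableEq ι] [Field F] (x : ι → F) (t : F) (I J : Finset ι)
    (i j : ι) : F :=
  (if i ∈ I ∧ j ∉ I then x i / (x i - x j) else 1) *
    (if i ∈ J ∧ j ∉ J then gam t I i * x i / (gam t I i * x i - gam t I j * x j) else 1)

/-- Total weight. -/
def Wt {ι F : Type*} [Fintype ι] [DecidableEq ι] [Field F] (x : ι → F) (t : F)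
    (I J : Finset ι) : F := ∏ i, ∏ j, pw x t I J i j

lemma prod_pairs {ι F : Type*} [Fintype ι] [DecidableEq ι] [Field F] (w : ι → ι → F) (p : ι) :
    ∏ i, ∏ j, w i j = (w p p * ∏ i ∈ Finset.univ.erase p, ∏ j ∈ Finset.univ.erase p, w i j) *
      ∏ j ∈ Finset.univ.erase p, (w p j * w j p) := by
  rw [← Finset.mul_prod_erase _ _ (Finset.mem_univ p),
    ← Finset.mul_prod_erase _ (w p) (Finset.mem_univ p)]
  have : ∀ i, ∏ j, w i j = w i p * ∏ j ∈ Finset.univ.erase p, w i j := fun i =>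
    (Finset.mul_prod_erase _ _ (Finset.mem_univ p)).symm
  simp only [this, Finset.prod_mul_distrib]
  ring

lemma prod_sub_ite {ι F : Type*} [Fintype ι] [DecidableEq ι] [Field F] (S : Finset ι) (p : ι)
    (hp : p ∉ S) (g : ι → F) :
    ∏ j ∈ S, g j = ∏ j ∈ Finset.univ.erase p, (if j ∈ S then g j else 1) := by
  rw [Finset.prod_ite_mem]
  congr 1
  ext j
  simp only [Finset.mem_inter, Finset.mem_erase, Finset.mem_univ, and_true]
  constructor
  · intro h; exact ⟨fun e => hp (e ▸ h), h⟩
  · exact fun h => h.2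

lemma move {ι F : Type*} [Fintype ι] [DecidableEq ι] [Field F] (x : ι → F) (t : F)
    (ht : t ≠ 0) (hx : ∀ i, x i ≠ 0) (hinj : Function.Injective x)
    (hxt : ∀ i j, i ≠ j → x i - t * x j ≠ 0) (I J : Finset ι) (p : ι) (hI : p ∉ I) (hJ : p ∉ J) :
    Wt x t (insert p I) J *
      ((∏ s ∈ J \ I, (1 - t * x p / x s)) * ∏ j ∈ I \ J, x j / (x j - x p)) =
    Wt x t I (insert p J) *
      ((∏ j ∈ I \ J, (1 - t * x j / x p)) * ∏ s ∈ J \ I, x p / (x p - x s)) := by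
  have h1 : p ∉ I \ J := by simp [hI]
  have h2 : p ∉ J \ I := by simp [hJ]
  unfold Wt
  rw [prod_pairs (pw x t (insert p I) J) p, prod_pairs (pw x t I (insert p J)) p, prod_sub_ite _ p h1, prod_sub_ite _ p h1, prod_sub_ite _ p h2,
    prod_sub_ite _ p h2, mul_assoc (pw x t (insert p I) J p p * _), mul_assoc (pw x t I (insert p J) p p * _), ← Finset.prod_mul_distrib, ← Finset.prod_mul_distrib,
    ← Finset.prod_mul_distrib, ← Finset.prod_mul_distrib]
  congr 1
  · congr 1
    · simp [pw, hI, hJ]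
    · refine Finset.prod_congr rfl fun i hi => Finset.prod_congr rfl fun j hj => ?_
      have hi := Finset.ne_of_mem_erase hi
      have hj := Finset.ne_of_mem_erase hj
      simp [pw, gam, hi, hj]
  · refine Finset.prod_congr rfl fun j hj => ?_
    have hj := Finset.ne_of_mem_erase hj
    have a1 : x j - x p ≠ 0 := sub_ne_zero.2 (hinj.ne hj)
    have a2 : x p - x j ≠ 0 := sub_ne_zero.2 (hinj.ne hj.symm)
    have a3 := hxt j p hj
    have a4 := hxt p j hj.symm
    have a5 := hx j
    have a6 := hx p
    by_cases c1 : j ∈ I <;> by_cases c2 : j ∈ J <;>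
      simp only [pw, gam, hI, hJ, c1, c2, hj, hj.symm, Finset.mem_insert, Finset.mem_sdiff, or_true,
        true_or, or_false, false_or, not_true_eq_false, not_false_eq_true, and_true, and_false,
        true_and, false_and, if_true, if_false, one_mul, mul_one]
    · rw [← mul_sub, mul_div_mul_left _ _ ht]
    · rw [mul_comm t (x j)] at a4
      field_simp
    · rw [mul_comm t (x p)] at a3
      field_simp

/-- Powers of the variables. -/
def Ex {ι F : Type*} [DecidableEq ι] [Field F] (x : ι → F) (t : F) (k : ℤ)
    (I J : Finset ι) : F := (∏ i ∈ I, x i ^ k) * ∏ i ∈ J, (gam t I i * x i) ^ k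

lemma Ex_move {ι F : Type*} [DecidableEq ι] [Field F] (x : ι → F) (t : F) (k : ℤ)
    (I J : Finset ι) (p : ι) (hI : p ∉ I) (hJ : p ∉ J) :
    Ex x t k (insert p I) J = Ex x t k I (insert p J) := by
  unfold Ex
  rw [Finset.prod_insert hI, Finset.prod_insert hJ]
  have : ∏ i ∈ J, (gam t (insert p I) i * x i) ^ k = ∏ i ∈ J, (gam t I i * x i) ^ k := by
    refine Finset.prod_congr rfl fun i hi => ?_
    have : i ≠ p := fun e => hJ (e ▸ hi)
    simp [gam, this]
  rw [this]
  simp only [gam, hI, if_false, one_mul]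
  ring

lemma Ex_shift {ι F : Type*} [DecidableEq ι] [Field F] (x : ι → F) (t : F) (k : ℤ)
    (ht : t ≠ 0) (hx : ∀ i, x i ≠ 0) (I J : Finset ι) :
    t ^ I.card * ((∏ i ∈ I, x i ^ (k + 1)) * ∏ i ∈ J, (gam t I i * x i) ^ (k - 1)) =
      ((∏ i ∈ I \ J, (t * x i)) * ∏ i ∈ J \ I, (x i)⁻¹) * Ex x t k I J := by
  unfold Ex
  have e1 : t ^ I.card * (∏ i ∈ I, x i ^ (k + 1)) = (∏ i ∈ I, (t * x i)) * ∏ i ∈ I, x i ^ k := by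
    rw [← Finset.prod_const, ← Finset.prod_mul_distrib, ← Finset.prod_mul_distrib]
    refine Finset.prod_congr rfl fun i _ => ?_
    rw [zpow_add_one₀ (hx i)]; ring
  have e2 : ∏ i ∈ J, (gam t I i * x i) ^ (k - 1) =
      (∏ i ∈ J, (gam t I i * x i)⁻¹) * ∏ i ∈ J, (gam t I i * x i) ^ k := by
    rw [← Finset.prod_mul_distrib]
    refine Finset.prod_congr rfl fun i _ => ?_
    have : gam t I i * x i ≠ 0 := mul_ne_zero (by unfold gam; split_ifs <;> simp [ht]) (hx i)
    rw [zpow_sub_one₀ this]; ring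
  have e3 : (∏ i ∈ I, (t * x i)) * (∏ i ∈ J, (gam t I i * x i)⁻¹) =
      (∏ i ∈ I \ J, (t * x i)) * ∏ i ∈ J \ I, (x i)⁻¹ := by
    rw [← Finset.prod_sdiff (Finset.inter_subset_left : I ∩ J ⊆ I),
      ← Finset.prod_sdiff (Finset.inter_subset_right : I ∩ J ⊆ J), Finset.sdiff_inter_self_left,
      Finset.sdiff_inter_self_right]
    have f1 : (∏ i ∈ I ∩ J, (t * x i)) * ∏ i ∈ I ∩ J, (gam t I i * x i)⁻¹ = 1 := by
      rw [← Finset.prod_mul_distrib]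
      refine Finset.prod_eq_one fun i hi => ?_
      have hi := (Finset.mem_inter.1 hi).1
      simp only [gam, hi, if_true]
      exact mul_inv_cancel₀ (mul_ne_zero ht (hx i))
    have f2 : ∏ i ∈ J \ I, (gam t I i * x i)⁻¹ = ∏ i ∈ J \ I, (x i)⁻¹ := by
      refine Finset.prod_congr rfl fun i hi => ?_
      simp [gam, (Finset.mem_sdiff.1 hi).2]
    rw [f2]
    linear_combination (∏ i ∈ I \ J, (t * x i)) * (∏ i ∈ J \ I, (x i)⁻¹) * f1
  rw [e2, ← e3]
  linear_combination (∏ i ∈ J, (gam t I i * x i)⁻¹) * (∏ i ∈ J, (gam t I i * x i) ^ k) * e1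

lemma prod_prod_ite {ι F : Type*} [Fintype ι] [DecidableEq ι] [Field F] (I : Finset ι)
    (w : ι → ι → F) :
    ∏ i ∈ I, ∏ j ∈ Finset.univ \ I, w i j = ∏ i, ∏ j, if i ∈ I ∧ j ∉ I then w i j else 1 := by
  rw [← Finset.prod_subset (Finset.subset_univ I)]
  · refine Finset.prod_congr rfl fun i hi => ?_
    rw [← Finset.prod_subset (Finset.subset_univ (Finset.univ \ I))]
    · refine Finset.prod_congr rfl fun j hj => ?_
      rw [if_pos ⟨hi, (Finset.mem_sdiff.1 hj).2⟩]
    · intro j _ hj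
      rw [if_neg (by simpa using fun _ => hj)]
  · intro i _ hi
    refine Finset.prod_eq_one fun j _ => ?_
    rw [if_neg (fun h => hi h.1)]

/-- The combinatorial core. -/
lemma core {ι F : Type*} [Fintype ι] [DecidableEq ι] [Field F] (x : ι → F) (t : F)
    (ht : t ≠ 0) (hx : ∀ i, x i ≠ 0) (hinj : Function.Injective x)
    (hxt : ∀ i j, i ≠ j → x i - t * x j ≠ 0) (H : Finset ι → Finset ι → F)
    (hH : ∀ I J p, p ∉ I → p ∉ J → H (insert p I) J = H I (insert p J)) (a : ℕ) (ha : 1 ≤ a) :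
    ∑ I ∈ Finset.powersetCard a (Finset.univ : Finset ι), ∑ J ∈ Finset.powersetCard a Finset.univ,
      (1 - (∏ p ∈ I \ J, (t * x p)) * ∏ s ∈ J \ I, (x s)⁻¹) * (Wt x t I J * H I J) =
    ∑ I ∈ Finset.powersetCard (a - 1) (Finset.univ : Finset ι),
      ∑ J ∈ Finset.powersetCard (a + 1) Finset.univ, Wt x t I J * H I J := by
  have hL : ∀ I ∈ Finset.powersetCard a (Finset.univ : Finset ι),
      ∀ J ∈ Finset.powersetCard a (Finset.univ : Finset ι),
      (1 - (∏ p ∈ I \ J, (t * x p)) * ∏ s ∈ J \ I, (x s)⁻¹) * (Wt x t I J * H I J) =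
      ∑ p ∈ I \ J, ((∏ s ∈ J \ I, (1 - t * x p / x s)) * ∏ j ∈ (I \ J).erase p, x j / (x j - x p)) *
        (Wt x t I J * H I J) := by
    intro I hI J hJ
    rw [sum_one (I \ J) (J \ I) x t ht hx hinj, Finset.sum_mul]
    exact Finset.card_sdiff_comm (by
      rw [(Finset.mem_powersetCard.1 hI).2, (Finset.mem_powersetCard.1 hJ).2])
  have hR : ∀ I ∈ Finset.powersetCard (a - 1) (Finset.univ : Finset ι),
      ∀ J ∈ Finset.powersetCard (a + 1) (Finset.univ : Finset ι),
      Wt x t I J * H I J =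
      ∑ p ∈ J \ I, ((∏ j ∈ I \ J, (1 - t * x j / x p)) * ∏ s ∈ (J \ I).erase p, x p / (x p - x s)) *
        (Wt x t I J * H I J) := by
    intro I hI J hJ
    rw [← Finset.sum_mul, ← sum_two (I \ J) (J \ I) x t hx hinj, one_mul]
    have h1 := Finset.card_sdiff_add_card_inter I J
    have h2 := Finset.card_sdiff_add_card_inter J I
    rw [(Finset.mem_powersetCard.1 hI).2] at h1
    rw [(Finset.mem_powersetCard.1 hJ).2, Finset.inter_comm] at h2
    omega
  rw [Finset.sum_congr rfl fun I hI => Finset.sum_congr rfl (hL I hI),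
    Finset.sum_congr rfl fun I hI => Finset.sum_congr rfl (hR I hI)]
  simp only [Finset.sum_sigma']
  refine Finset.sum_bij' (fun z _ => ⟨z.1.erase z.2.2, insert z.2.2 z.2.1, z.2.2⟩)
    (fun z _ => ⟨insert z.2.2 z.1, z.2.1.erase z.2.2, z.2.2⟩) ?_ ?_ ?_ ?_ ?_
  · rintro ⟨I, J, p⟩ h
    simp only [Finset.mem_sigma, Finset.mem_powersetCard, Finset.subset_univ, true_and,
      Finset.mem_sdiff] at h ⊢
    obtain ⟨h1, h2, h3, h4⟩ := h
    refine ⟨by rw [Finset.card_erase_of_mem h3, h1], by rw [Finset.card_insert_of_notMem h4, h2],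
      by simp, by simp⟩
  · rintro ⟨I, J, p⟩ h
    simp only [Finset.mem_sigma, Finset.mem_powersetCard, Finset.subset_univ, true_and,
      Finset.mem_sdiff] at h ⊢
    obtain ⟨h1, h2, h3, h4⟩ := h
    refine ⟨by rw [Finset.card_insert_of_notMem h4, h1]; omega,
      by rw [Finset.card_erase_of_mem h3, h2]; omega, by simp, by simp⟩
  · rintro ⟨I, J, p⟩ h
    simp only [Finset.mem_sigma, Finset.mem_sdiff] at h
    obtain ⟨h1, h2, h3, h4⟩ := h
    simp [Finset.insert_erase h3, Finset.erase_insert h4]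
  · rintro ⟨I, J, p⟩ h
    simp only [Finset.mem_sigma, Finset.mem_sdiff] at h
    obtain ⟨h1, h2, h3, h4⟩ := h
    simp [Finset.insert_erase h3, Finset.erase_insert h4]
  · rintro ⟨I, J, p⟩ h
    simp only [Finset.mem_sigma, Finset.mem_sdiff] at h
    obtain ⟨h1, h2, h3, h4⟩ := h
    obtain ⟨I, h5, rfl⟩ : ∃ I', p ∉ I' ∧ insert p I' = I :=
      ⟨I.erase p, by simp, Finset.insert_erase h3⟩
    dsimp only
    rw [Finset.erase_insert h5]
    have e1 : J \ insert p I = J \ I := by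
      ext j; simp only [Finset.mem_sdiff, Finset.mem_insert]; grind
    have e2 : (insert p I \ J).erase p = I \ J := by
      ext j; simp only [Finset.mem_sdiff, Finset.mem_insert, Finset.mem_erase]; grind
    have e3 : I \ insert p J = I \ J := by
      ext j; simp only [Finset.mem_sdiff, Finset.mem_insert]; grind
    have e4 : (insert p J \ I).erase p = J \ I := by
      ext j; simp only [Finset.mem_sdiff, Finset.mem_insert, Finset.mem_erase]; grind
    rw [e1, e2, e3, e4, hH I J p h5 h4]
    linear_combination H I (insert p J) * move x t ht hx hinj hxt I J p h5 h4

section Rat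

variable {N : ℕ} {K : Type*} [Field K]

lemma Xvar_ne_zero (i : Fin N) : Xvar N K i ≠ 0 := by
  unfold Xvar
  simp [MvPolynomial.X_ne_zero]

lemma Xvar_inj : Function.Injective (Xvar N K) := by
  intro i j h
  exact MvPolynomial.X_injective (IsFractionRing.injective (MvPolynomial (Fin N) K) (RatFun N K) h)

lemma Xvar_sub (q : K) (i j : Fin N) (hij : i ≠ j) :
    Xvar N K i - algebraMap K (RatFun N K) q * Xvar N K j ≠ 0 := by
  unfold Xvar
  rw [IsScalarTower.algebraMap_apply K (MvPolynomial (Fin N) K) (RatFun N K), ← map_mul, ← map_sub]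
  intro h
  have h := (map_eq_zero_iff _ (IsFractionRing.injective (MvPolynomial (Fin N) K) (RatFun N K))).1 h
  have := congrArg (MvPolynomial.eval (fun l : Fin N => if l = i then (1 : K) else 0)) h
  simp [hij.symm] at this

lemma hom_ext (φ ψ : RatFun N K →ₐ[K] RatFun N K)
    (h : ∀ i, φ (Xvar N K i) = ψ (Xvar N K i)) : φ = ψ := by
  apply IsLocalization.algHom_ext (W := nonZeroDivisors (MvPolynomial (Fin N) K))
    (A := MvPolynomial (Fin N) K)
  apply MvPolynomial.algHom_ext
  exact h

variable (Γ : Finset (Fin N) → (RatFun N K ≃ₐ[K] RatFun N K)) (q : K)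
    (hΓ : ∀ (I : Finset (Fin N)) (j : Fin N),
      Γ I (Xvar N K j) =
        (if j ∈ I then algebraMap K (RatFun N K) q else 1) * Xvar N K j)

lemma Gam_move (hΓ : ∀ (I : Finset (Fin N)) (j : Fin N),
      Γ I (Xvar N K j) =
        (if j ∈ I then algebraMap K (RatFun N K) q else 1) * Xvar N K j)
    (I J : Finset (Fin N)) (p : Fin N) (hI : p ∉ I) (hJ : p ∉ J) (f : RatFun N K) :
    Γ (insert p I) (Γ J f) = Γ I (Γ (insert p J) f) := by
  have := hom_ext ((Γ (insert p I) : RatFun N K →ₐ[K] RatFun N K).comp (Γ J))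
    ((Γ I : RatFun N K →ₐ[K] RatFun N K).comp (Γ (insert p J))) (by
      intro i
      have hif : ∀ (L : Finset (Fin N)) (c : Prop) [Decidable c],
          Γ L (if c then algebraMap K (RatFun N K) q else 1) =
            if c then algebraMap K (RatFun N K) q else 1 := by
        intro L c _; split_ifs <;> simp
      change Γ (insert p I) (Γ J (Xvar N K i)) = Γ I (Γ (insert p J) (Xvar N K i))
      rw [hΓ, hΓ, map_mul, map_mul, hif, hif, hΓ, hΓ]
      by_cases hi : i = p
      · subst hi; simp [hI, hJ]
      · simp only [Finset.mem_insert, hi, false_or]; try ring)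
  exact DFunLike.congr_fun this f

lemma Gam_empty (hΓ : ∀ (I : Finset (Fin N)) (j : Fin N),
      Γ I (Xvar N K j) =
        (if j ∈ I then algebraMap K (RatFun N K) q else 1) * Xvar N K j) (f : RatFun N K) :
    Γ ∅ f = f := by
  have := hom_ext (Γ ∅ : RatFun N K →ₐ[K] RatFun N K) (AlgHom.id K _) (by
    intro i; simp [hΓ])
  exact DFunLike.congr_fun this f

lemma D_eq (hΓ : ∀ (I : Finset (Fin N)) (j : Fin N),
      Γ I (Xvar N K j) =
        (if j ∈ I then algebraMap K (RatFun N K) q else 1) * Xvar N K j)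
    (a : ℕ) (k : ℤ) (f : RatFun N K) : Dwhittaker Γ a k f =
    ∑ I ∈ Finset.powersetCard a (Finset.univ : Finset (Fin N)),
      ((∏ i ∈ I, Xvar N K i ^ k) *
          ∏ i ∈ I, ∏ j ∈ Finset.univ \ I, Xvar N K i / (Xvar N K i - Xvar N K j)) *
        Γ I f := by
  unfold Dwhittaker
  split_ifs with h
  · subst h
    simp [Gam_empty Γ q hΓ]
  · rfl

lemma DD_eq (hΓ : ∀ (I : Finset (Fin N)) (j : Fin N),
      Γ I (Xvar N K j) =
        (if j ∈ I then algebraMap K (RatFun N K) q else 1) * Xvar N K j)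
    (a b : ℕ) (k l : ℤ) (f : RatFun N K) : Dwhittaker Γ a k (Dwhittaker Γ b l f) =
    ∑ I ∈ Finset.powersetCard a (Finset.univ : Finset (Fin N)),
    ∑ J ∈ Finset.powersetCard b (Finset.univ : Finset (Fin N)),
      ((∏ i ∈ I, Xvar N K i ^ k) *
        ∏ i ∈ J, (gam (algebraMap K (RatFun N K) q) I i * Xvar N K i) ^ l) *
      (Wt (Xvar N K) (algebraMap K (RatFun N K) q) I J * Γ I (Γ J f)) := by
  rw [D_eq Γ q hΓ]
  refine Finset.sum_congr rfl fun I _ => ?_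
  rw [D_eq Γ q hΓ, map_sum, Finset.mul_sum]
  refine Finset.sum_congr rfl fun J _ => ?_
  simp only [map_mul, map_prod, map_zpow₀, map_div₀, map_sub, hΓ]
  unfold Wt pw
  simp only [Finset.prod_mul_distrib, prod_prod_ite]
  simp only [gam]
  ring

end Rat

end QSys

/-- The generalized q-Whittaker difference operators of type `A_{N-1}^{(1)}` satisfy the
quantum Q-system exchange relation:
`q^a · D_{a;k+1} ∘ D_{a;k-1} = D_{a;k} ∘ D_{a;k} - D_{a-1;k} ∘ D_{a+1;k}`
for all `a ∈ {1,…,N}` and `k ∈ ℤ`, with conventions `D_{0;k} = id`, `D_{N+1;k} = 0`. -/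
theorem quantum_Q_system_exchange
    (N : ℕ) (hN : 1 ≤ N) (K : Type*) [Field K] (q : K) (hq : q ≠ 0)
    (Γ : Finset (Fin N) → (RatFun N K ≃ₐ[K] RatFun N K))
    (hΓ : ∀ (I : Finset (Fin N)) (j : Fin N),
      Γ I (Xvar N K j) =
        (if j ∈ I then algebraMap K (RatFun N K) q else 1) * Xvar N K j)
    (a : ℕ) (ha1 : 1 ≤ a) (haN : a ≤ N) (k : ℤ) (f : RatFun N K) :
    algebraMap K (RatFun N K) q ^ a * Dwhittaker Γ a (k + 1) (Dwhittaker Γ a (k - 1) f) =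
      Dwhittaker Γ a k (Dwhittaker Γ a k f) -
        Dwhittaker Γ (a - 1) k (Dwhittaker Γ (a + 1) k f) := by
  have ht : algebraMap K (RatFun N K) q ≠ 0 := by simpa using hq
  have hc := QSys.core (Xvar N K) (algebraMap K (RatFun N K) q) ht QSys.Xvar_ne_zero QSys.Xvar_inj
    (QSys.Xvar_sub q)
    (fun I J => QSys.Ex (Xvar N K) (algebraMap K (RatFun N K) q) k I J * Γ I (Γ J f))
    (fun I J p hI hJ => by
      simp only [QSys.Ex_move _ _ _ I J p hI hJ, QSys.Gam_move Γ q hΓ I J p hI hJ f]) a ha1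
  have e : algebraMap K (RatFun N K) q ^ a *
        Dwhittaker Γ a (k + 1) (Dwhittaker Γ a (k - 1) f) -
      Dwhittaker Γ a k (Dwhittaker Γ a k f) =
      - Dwhittaker Γ (a - 1) k (Dwhittaker Γ (a + 1) k f) := by
    rw [QSys.DD_eq Γ q hΓ, QSys.DD_eq Γ q hΓ, QSys.DD_eq Γ q hΓ]
    have h2 : ∀ I J : Finset (Fin N), (∏ i ∈ I, Xvar N K i ^ k) *
        (∏ i ∈ J, (QSys.gam (algebraMap K (RatFun N K) q) I i * Xvar N K i) ^ k) =
        QSys.Ex (Xvar N K) (algebraMap K (RatFun N K) q) k I J := fun _ _ => rfl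
    simp only [h2]
    simp only [mul_left_comm (QSys.Wt _ _ _ _)] at hc
    rw [← hc, ← Finset.sum_neg_distrib, Finset.mul_sum, ← Finset.sum_sub_distrib]
    refine Finset.sum_congr rfl fun I hI => ?_
    rw [← Finset.sum_neg_distrib, Finset.mul_sum, ← Finset.sum_sub_distrib]
    refine Finset.sum_congr rfl fun J _ => ?_
    have h3 := QSys.Ex_shift (Xvar N K) (algebraMap K (RatFun N K) q) k ht QSys.Xvar_ne_zero I J
    rw [(Finset.mem_powersetCard.1 hI).2] at h3
    rw [← mul_assoc, h3]
    ring
  linear_combination e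
end
end

section
/- Let R be a commutative ring, N ≥ 1, and let x_1,…,x_N and y_1,…,y_N be invertible elements of R. Write x̃_i = x_i + x_i^{−1} and ỹ_i = y_i + y_i^{−1}. Then for every 0 ≤ m ≤ N: ê_m(x_1,…,x_N) = ê_m(y_1,…,y_N) + Σ_{j=1}^{m} ê_{m−j}(y_1,…,y_{N−j}) · [ Σ_{k=0}^{j} (−1)^k e_{j−k}(x̃_1,…,x̃_N) h_k(ỹ_1,…,ỹ_{N−j+1}) ]. -/
open scoped BigOperators

noncomputable section

/-- The elementary symmetric polynomial `e_k` of the family `(u_i)_{i ∈ s}`. -/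
def esym {R : Type*} [CommRing R] (k : ℕ) (s : Finset ℕ) (u : ℕ → R) : R :=
  ∑ S ∈ Finset.powersetCard k s, ∏ i ∈ S, u i

/-- The complete homogeneous symmetric polynomial `h_k` of the family `(u_i)_{i ∈ s}`. -/
def hsym {R : Type*} [CommRing R] (k : ℕ) (s : Finset ℕ) (u : ℕ → R) : R :=
  ∑ m ∈ s.sym k, ((m : Multiset ℕ).map u).prod

/-- The BC-type elementary symmetric function `ê_k` of a family of invertible elements
`(z_i)_{i ∈ s}`:
`ê_k = ∑_{S, T ⊆ s, |S| + |T| = k} (∏_{i∈S} z_i)(∏_{i∈T} z_i⁻¹)`,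
equivalently the coefficient of `z^k` in `∏_{i∈s} (1 + z z_i)(1 + z z_i⁻¹)`. -/
def ehat {R : Type*} [CommRing R] (k : ℕ) (s : Finset ℕ) (z : ℕ → Rˣ) : R :=
  ∑ p ∈ (s.powerset ×ˢ s.powerset).filter (fun p => p.1.card + p.2.card = k),
    (∏ i ∈ p.1, (z i : R)) * ∏ i ∈ p.2, (((z i)⁻¹ : Rˣ) : R)

open Polynomial in
lemma ehat_eq_coeff {R : Type*} [CommRing R] (k : ℕ) (s : Finset ℕ) (z : ℕ → Rˣ) :
    ehat k s z = (∏ i ∈ s, ((1 + X ^ 2 : R[X]) + X * C ((z i : R) + (((z i)⁻¹ : Rˣ) : R)))).coeff k := by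
  have h : (∏ i ∈ s, ((1 + X ^ 2 : R[X]) + X * C ((z i : R) + (((z i)⁻¹ : Rˣ) : R))))
      = (∏ i ∈ s, (1 + X * C (z i : R))) * ∏ i ∈ s, (1 + X * C (((z i)⁻¹ : Rˣ) : R)) := by
    rw [← Finset.prod_mul_distrib]
    refine Finset.prod_congr rfl fun i _ => ?_
    have h1 : (C (z i : R)) * C (((z i)⁻¹ : Rˣ) : R) = 1 := by
      rw [← C_mul]; simp
    rw [C_add]
    linear_combination (-X ^ 2) * h1
  rw [h, Finset.prod_one_add, Finset.prod_one_add, Finset.sum_mul_sum, ← Finset.sum_product',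
    finsetSum_coeff, ehat, Finset.sum_filter]
  refine Finset.sum_congr rfl fun p _ => ?_
  rw [Finset.prod_mul_distrib, Finset.prod_mul_distrib, Finset.prod_const, Finset.prod_const,
    ← map_prod, ← map_prod]
  have : (X ^ p.1.card * C (∏ i ∈ p.1, (z i : R)) * (X ^ p.2.card *
      C (∏ i ∈ p.2, (((z i)⁻¹ : Rˣ) : R)))) = C ((∏ i ∈ p.1, (z i : R)) *
      ∏ i ∈ p.2, (((z i)⁻¹ : Rˣ) : R)) * X ^ (p.1.card + p.2.card) := by
    rw [C_mul]; ring
  rw [this, coeff_C_mul_X_pow]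
  simp only [eq_comm]

lemma hsym_zero {R : Type*} [CommRing R] (s : Finset ℕ) (u : ℕ → R) : hsym 0 s u = 1 := by
  simp only [hsym, Finset.sym_zero, Finset.sum_singleton]
  exact Multiset.prod_zero

lemma hsym_empty {R : Type*} [CommRing R] (k : ℕ) (u : ℕ → R) : hsym (k + 1) ∅ u = 0 := by
  simp [hsym]

lemma hsym_succ {R : Type*} [CommRing R] (k : ℕ) (s : Finset ℕ) (a : ℕ) (ha : a ∉ s) (u : ℕ → R) :
    hsym (k + 1) (insert a s) u = hsym (k + 1) s u + u a * hsym k (insert a s) u := by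
  unfold hsym
  rw [← Finset.sum_filter_not_add_sum_filter _ (fun m : Sym ℕ (k + 1) => a ∈ m)]
  congr 1
  · refine Finset.sum_congr ?_ fun _ _ => rfl
    ext m
    simp only [Finset.mem_filter, Finset.mem_sym_iff, Finset.mem_insert]
    constructor
    · rintro ⟨h, h2⟩ b hb
      rcases h b hb with rfl | h
      · exact absurd hb h2
      · exact h
    · intro h
      exact ⟨fun b hb => Or.inr (h b hb), fun h2 => ha (h a h2)⟩
  · rw [Finset.mul_sum]
    symm
    refine Finset.sum_bij (fun m _ => a ::ₛ m) ?_ ?_ ?_ ?_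
    · intro m hm
      simp only [Finset.mem_filter, Finset.mem_sym_iff, Sym.mem_cons] at hm ⊢
      refine ⟨?_, by simp⟩
      rintro b (rfl | hb)
      · simp
      · exact hm b hb
    · intro m _ m' _ h
      exact Sym.cons_inj_right _ _ _ |>.1 h
    · intro m hm
      simp only [Finset.mem_filter, Finset.mem_sym_iff] at hm
      obtain ⟨m', rfl⟩ := Sym.exists_cons_of_mem hm.2
      refine ⟨m', ?_, rfl⟩
      simp only [Finset.mem_sym_iff]
      exact fun b hb => hm.1 b (Sym.mem_cons_of_mem hb)
    · intro m _
      show _ = (Multiset.map u ((a ::ₛ m : Sym ℕ (k + 1)) : Multiset ℕ)).prod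
      rw [Sym.coe_cons, Multiset.map_cons, Multiset.prod_cons]

lemma Icc_ins (n : ℕ) : Finset.Icc 1 (n + 1) = insert (n + 1) (Finset.Icc 1 n) := by
  ext; simp; omega

lemma hsym_Icc {R : Type*} [CommRing R] (k n : ℕ) (u : ℕ → R) :
    hsym (k + 1) (Finset.Icc 1 (n + 1)) u =
      hsym (k + 1) (Finset.Icc 1 n) u + u (n + 1) * hsym k (Finset.Icc 1 (n + 1)) u := by
  rw [Icc_ins, hsym_succ _ _ _ (by simp)]

open Polynomial in
/-- Expansion of a power in the basis of products. -/
lemma pow_expand {R : Type*} [CommRing R] (w : R[X]) (u : ℕ → R) (n : ℕ) :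
    w ^ n = ∑ i ∈ Finset.range (n + 1), (-X) ^ (n - i) *
      C (hsym (n - i) (Finset.Icc 1 (i + 1)) u) * ∏ l ∈ Finset.Icc 1 i, (w + X * C (u l)) := by
  induction n with
  | zero => simp [hsym_zero]
  | succ n ih =>
    set P : ℕ → R[X] := fun i => ∏ l ∈ Finset.Icc 1 i, (w + X * C (u l)) with hP
    have hPs : ∀ i, P (i + 1) = (w + X * C (u (i + 1))) * P i := by
      intro i
      simp only [hP]
      rw [Icc_ins, Finset.prod_insert (by simp)]
    have key : ∀ i ∈ Finset.range (n + 1), w * ((-X) ^ (n - i) *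
        C (hsym (n - i) (Finset.Icc 1 (i + 1)) u) * P i) =
        (-X) ^ (n + 1 - i) * C (hsym (n + 1 - i) (Finset.Icc 1 (i + 1)) u) * P i +
        ((-X) ^ (n + 1 - (i + 1)) * C (hsym (n + 1 - (i + 1)) (Finset.Icc 1 (i + 1)) u) * P (i + 1)
        - (-X) ^ (n + 1 - i) * C (hsym (n + 1 - i) (Finset.Icc 1 i) u) * P i) := by
      intro i hi
      have hi : i ≤ n := by simpa [Nat.lt_succ_iff] using hi
      obtain ⟨d, rfl⟩ := Nat.exists_eq_add_of_le hi
      have e1 : i + d - i = d := by omega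
      have e2 : i + d + 1 - i = d + 1 := by omega
      have e3 : i + d + 1 - (i + 1) = d := by omega
      rw [e1, e2, e3, hPs, hsym_Icc, C_add, C_mul]
      ring
    rw [pow_succ', ih, Finset.mul_sum, Finset.sum_congr rfl key, Finset.sum_add_distrib,
      Finset.sum_range_sub (fun i => (-X) ^ (n + 1 - i) *
        C (hsym (n + 1 - i) (Finset.Icc 1 i) u) * P i), Finset.sum_range_succ _ (n + 1)]
    simp [hsym_zero, hsym_empty, hP, X_mul_C]

open Polynomial in
lemma prod_expand {R : Type*} [CommRing R] (w : R[X]) (u : ℕ → R) (s : Finset ℕ) :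
    ∏ l ∈ s, (w + X * C (u l)) =
      ∑ l ∈ Finset.range (s.card + 1), X ^ l * C (esym l s u) * w ^ (s.card - l) := by
  simp_rw [add_comm w]
  rw [Finset.prod_add, Finset.sum_powerset]
  refine Finset.sum_congr rfl fun l _ => ?_
  rw [esym, map_sum, Finset.mul_sum, Finset.sum_mul]
  refine Finset.sum_congr rfl fun t ht => ?_
  rw [Finset.mem_powersetCard] at ht
  rw [Finset.prod_mul_distrib, Finset.prod_const, Finset.prod_const, ht.2, map_prod,
    Finset.card_sdiff_of_subset ht.1, ht.2]

open Polynomial in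
lemma poly_identity {R : Type*} [CommRing R] (w : R[X]) (a b : ℕ → R) (N : ℕ) :
    ∏ l ∈ Finset.Icc 1 N, (w + X * C (a l)) =
      ∑ j ∈ Finset.range (N + 1), X ^ j * ((∏ l ∈ Finset.Icc 1 (N - j), (w + X * C (b l))) *
        C (∑ k ∈ Finset.range (j + 1), (-1 : R) ^ k * esym (j - k) (Finset.Icc 1 N) a *
          hsym k (Finset.Icc 1 (N - j + 1)) b)) := by
  rw [prod_expand, Nat.card_Icc, Nat.add_sub_cancel]
  have h1 : ∀ l ∈ Finset.range (N + 1), X ^ l * C (esym l (Finset.Icc 1 N) a) * w ^ (N - l) =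
      ∑ k ∈ Finset.range (N + 1 - l), X ^ l * C (esym l (Finset.Icc 1 N) a) * ((-X) ^ k *
      C (hsym k (Finset.Icc 1 (N - l - k + 1)) b) *
        ∏ i ∈ Finset.Icc 1 (N - l - k), (w + X * C (b i))) := by
    intro l hl
    have hl : l ≤ N := by simpa [Nat.lt_succ_iff] using hl
    rw [pow_expand w b, ← Finset.sum_range_reflect, Finset.mul_sum]
    have : N - l + 1 = N + 1 - l := by omega
    rw [this]
    refine Finset.sum_congr rfl fun k hk => ?_
    have hk := Finset.mem_range.1 hk
    have e1 : N + 1 - l - 1 - k = N - l - k := by omega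
    have e2 : N - l - (N - l - k) = k := by omega
    rw [e1, e2]
  rw [Finset.sum_congr rfl h1, ← Finset.sum_range_diag_flip (N + 1) (fun l k =>
    X ^ l * C (esym l (Finset.Icc 1 N) a) * ((-X) ^ k *
      C (hsym k (Finset.Icc 1 (N - l - k + 1)) b) *
        ∏ i ∈ Finset.Icc 1 (N - l - k), (w + X * C (b i))))]
  refine Finset.sum_congr rfl fun j _ => ?_
  rw [← Finset.sum_range_reflect, map_sum, Finset.mul_sum, Finset.mul_sum]
  refine Finset.sum_congr rfl fun k hk => ?_
  have hk := Finset.mem_range.1 hk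
  have hkj : k ≤ j := by omega
  obtain ⟨d, rfl⟩ := Nat.exists_eq_add_of_le hkj
  have e1 : k + d + 1 - 1 - k = d := by omega
  have e2 : k + d - k = d := by omega
  have e3 : k + d - d = k := by omega
  have e4 : N - d - k = N - (k + d) := by omega
  simp only [e1, e2, e3, e4, C_mul, C_pow, C_neg, C_1]
  rw [neg_pow (X : R[X]) k]
  ring

/-- For invertible `x_1,…,x_N` and `y_1,…,y_N` in a commutative ring, with
`x̃_i = x_i + x_i⁻¹` and `ỹ_i = y_i + y_i⁻¹`, for every `0 ≤ m ≤ N`: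
`ê_m(x_1,…,x_N) = ê_m(y_1,…,y_N) + ∑_{j=1}^m ê_{m-j}(y_1,…,y_{N-j}) ·
  [∑_{k=0}^j (-1)^k e_{j-k}(x̃_1,…,x̃_N) h_k(ỹ_1,…,ỹ_{N-j+1})]`. -/
theorem ehat_expansion {R : Type*} [CommRing R] (N : ℕ) (hN : 1 ≤ N)
    (x y : ℕ → Rˣ) (m : ℕ) (hm : m ≤ N) :
    ehat m (Finset.Icc 1 N) x =
      ehat m (Finset.Icc 1 N) y +
        ∑ j ∈ Finset.Icc 1 m,
          ehat (m - j) (Finset.Icc 1 (N - j)) y *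
            ∑ k ∈ Finset.range (j + 1),
              (-1 : R) ^ k *
                esym (j - k) (Finset.Icc 1 N) (fun i => (x i : R) + (((x i)⁻¹ : Rˣ) : R)) *
                hsym k (Finset.Icc 1 (N - j + 1))
                  (fun i => (y i : R) + (((y i)⁻¹ : Rˣ) : R)) := by
  have h := congrArg (fun p : Polynomial R => p.coeff m) (poly_identity
    (1 + Polynomial.X ^ 2) (fun i => (x i : R) + (((x i)⁻¹ : Rˣ) : R))
    (fun i => (y i : R) + (((y i)⁻¹ : Rˣ) : R)) N)
  simp only [Polynomial.finsetSum_coeff, Polynomial.coeff_X_pow_mul', Polynomial.coeff_mul_C,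
    ← ehat_eq_coeff] at h
  rw [h, ← Finset.sum_filter]
  have hs : (Finset.range (N + 1)).filter (fun j => j ≤ m) = insert 0 (Finset.Icc 1 m) := by
    ext j; simp; omega
  rw [hs, Finset.sum_insert (by simp)]
  congr 1
  simp [hsym_zero, esym]
end
end

section
/- Let K be a field, N ≥ 1, let a, b, c, d, q, t and s_1,…,s_N be nonzero elements of K, and let σ ∈ K be nonzero with σ² = abcd/q. Set d_m := σ^m t^{mN − m(m+1)/2} · ê_m(s_1,…,s_N) for 0 ≤ m ≤ N (so d_0 = 1), and set d̂_N := (σ^N t^{N(N−1)/2} / (s_1 ⋯ s_N)) · ∏_{i=1}^N (1 − (ab/σ) s_i)(1 − (cd/(qσ)) s_i). Then d̂_N = d_N + Σ_{m=1}^{N} (−1)^m (a^m b^m + c^m d^m q^{−m}) t^{m(m−1)/2} d_{N−m}. (This is the relation between the eigenvalue of Rains' operator and the eigenvalues of the Koornwinder–Macdonald operators, with s_i = σ t^{N−i} q^{λ_i}.) -/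
open scoped BigOperators

noncomputable section

/-- The BC-type elementary symmetric function `ê_k` of a family of (nonzero) field
elements: `ê_k = ∑_{S, T ⊆ s, |S| + |T| = k} (∏_{i∈S} z_i)(∏_{i∈T} z_i⁻¹)`. -/
def ehatF {K : Type*} [Field K] (k : ℕ) (s : Finset ℕ) (z : ℕ → K) : K :=
  ∑ p ∈ (s.powerset ×ˢ s.powerset).filter (fun p => p.1.card + p.2.card = k),
    (∏ i ∈ p.1, z i) * ∏ i ∈ p.2, (z i)⁻¹

/-- `d_m = σ^m t^{mN - m(m+1)/2} ê_m(s_1,…,s_N)`. -/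
def dKM {K : Type*} [Field K] (N : ℕ) (σ t : K) (s : ℕ → K) (m : ℕ) : K :=
  σ ^ m * t ^ ((m : ℤ) * (N : ℤ) - ((m : ℤ) * ((m : ℤ) + 1)) / 2) *
    ehatF m (Finset.Icc 1 N) s

lemma ehatF_gen {K : Type*} [Field K] (s : Finset ℕ) (z : ℕ → K) (x : K) :
    ∏ i ∈ s, ((1 + x * z i) * (1 + x * (z i)⁻¹)) =
      ∑ k ∈ Finset.range (2 * s.card + 1), x ^ k * ehatF k s z := by
  rw [Finset.prod_mul_distrib, Finset.prod_one_add, Finset.prod_one_add,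
    Finset.sum_mul_sum, ← Finset.sum_product']
  rw [← Finset.sum_fiberwise_of_maps_to (t := Finset.range (2 * s.card + 1))
    (g := fun p : Finset ℕ × Finset ℕ => p.1.card + p.2.card)]
  · refine Finset.sum_congr rfl fun k _ => ?_
    rw [ehatF, Finset.mul_sum]
    refine Finset.sum_congr rfl fun p hp => ?_
    rw [← (Finset.mem_filter.1 hp).2, Finset.prod_mul_distrib, Finset.prod_mul_distrib,
      Finset.prod_const, Finset.prod_const, pow_add]
    ring
  · intro p hp
    simp only [Finset.mem_product, Finset.mem_powerset] at hp
    have h1 := Finset.card_le_card hp.1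
    have h2 := Finset.card_le_card hp.2
    simp only [Finset.mem_range]
    omega

lemma ehatF_symm {K : Type*} [Field K] (s : Finset ℕ) (z : ℕ → K)
    (hz : ∀ i ∈ s, z i ≠ 0) (m : ℕ) (hm : m ≤ s.card) :
    ehatF (s.card + m) s z = ehatF (s.card - m) s z := by
  have key : ∀ S ⊆ s, (∏ i ∈ s \ S, z i) = (∏ i ∈ s, z i) * ∏ i ∈ S, (z i)⁻¹ := by
    intro S hS
    have h0 : ∏ i ∈ S, z i ≠ 0 := Finset.prod_ne_zero_iff.2 fun i hi => hz i (hS hi)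
    rw [← Finset.prod_sdiff hS, Finset.prod_inv_distrib, mul_assoc, mul_inv_cancel₀ h0, mul_one]
  have hP : ∏ i ∈ s, z i ≠ 0 := Finset.prod_ne_zero_iff.2 hz
  unfold ehatF
  refine Finset.sum_bij' (fun p _ => (s \ p.2, s \ p.1)) (fun p _ => (s \ p.2, s \ p.1))
    ?_ ?_ ?_ ?_ ?_
  · intro p hp
    simp only [Finset.mem_filter, Finset.mem_product, Finset.mem_powerset] at hp ⊢
    have h1 := Finset.card_le_card hp.1.1
    have h2 := Finset.card_le_card hp.1.2
    refine ⟨⟨Finset.sdiff_subset, Finset.sdiff_subset⟩, ?_⟩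
    rw [Finset.card_sdiff_of_subset hp.1.1, Finset.card_sdiff_of_subset hp.1.2]
    omega
  · intro p hp
    simp only [Finset.mem_filter, Finset.mem_product, Finset.mem_powerset] at hp ⊢
    have h1 := Finset.card_le_card hp.1.1
    have h2 := Finset.card_le_card hp.1.2
    refine ⟨⟨Finset.sdiff_subset, Finset.sdiff_subset⟩, ?_⟩
    rw [Finset.card_sdiff_of_subset hp.1.1, Finset.card_sdiff_of_subset hp.1.2]
    omega
  · intro p hp
    simp only [Finset.mem_filter, Finset.mem_product, Finset.mem_powerset] at hp
    simp only [Finset.sdiff_sdiff_eq_self hp.1.1, Finset.sdiff_sdiff_eq_self hp.1.2]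
  · intro p hp
    simp only [Finset.mem_filter, Finset.mem_product, Finset.mem_powerset] at hp
    simp only [Finset.sdiff_sdiff_eq_self hp.1.1, Finset.sdiff_sdiff_eq_self hp.1.2]
  · intro p hp
    simp only [Finset.mem_filter, Finset.mem_product, Finset.mem_powerset] at hp
    dsimp only
    rw [Finset.prod_inv_distrib (s := s \ p.1), key _ hp.1.1, key _ hp.1.2, mul_inv,
      Finset.prod_inv_distrib (s := p.1), inv_inv]
    field_simp

lemma sum_range_split {K : Type*} [Field K] (N : ℕ) (f : ℕ → K) :
    ∑ k ∈ Finset.range (2 * N + 1), f k =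
      f N + ∑ m ∈ Finset.Icc 1 N, (f (N - m) + f (N + m)) := by
  have h1 : ∀ g : ℕ → K, ∑ m ∈ Finset.Icc 1 N, g m = ∑ j ∈ Finset.range N, g (j + 1) := by
    intro g
    rw [Finset.range_eq_Ico, Finset.sum_Ico_add' g 0 N 1]
    rfl
  rw [h1, Finset.sum_add_distrib, show 2 * N + 1 = N + (N + 1) by ring, Finset.sum_range_add,
    Finset.sum_range_succ', ← Finset.sum_range_reflect]
  have h2 : ∑ j ∈ Finset.range N, f (N - 1 - j) = ∑ j ∈ Finset.range N, f (N - (j + 1)) :=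
    Finset.sum_congr rfl fun j _ => by congr 1; omega
  rw [h2, add_zero]
  ring

lemma t_exp (N m : ℕ) (hm : m ≤ N) :
    ((m : ℤ) * ((m : ℤ) - 1)) / 2 + (((N - m : ℕ) : ℤ) * (N : ℤ) -
      (((N - m : ℕ) : ℤ) * (((N - m : ℕ) : ℤ) + 1)) / 2) = ((N : ℤ) * ((N : ℤ) - 1)) / 2 := by
  obtain ⟨k, rfl⟩ := Nat.exists_eq_add_of_le hm
  have e : m + k - m = k := by omega
  rw [e]
  have ev : ∀ n : ℤ, ∃ r, n * (n - 1) = 2 * r := fun n => by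
    obtain ⟨r, hr⟩ := Int.even_mul_pred_self n
    exact ⟨r, by rw [hr]; ring⟩
  obtain ⟨r1, h1⟩ := ev m
  obtain ⟨r2, h2⟩ := ev (k + 1)
  obtain ⟨r3, h3⟩ := ev ((m + k : ℕ) : ℤ)
  have h2' : (k : ℤ) * (k + 1) = 2 * r2 := by rw [← h2]; ring
  rw [h1, h2', h3]
  push_cast at *
  rw [Int.mul_ediv_cancel_left _ two_ne_zero, Int.mul_ediv_cancel_left _ two_ne_zero,
    Int.mul_ediv_cancel_left _ two_ne_zero]
  nlinarith

/-- The relation between the eigenvalue of Rains' operator and the eigenvalues of the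
Koornwinder–Macdonald operators: with `σ² = abcd/q` and
`d̂_N = (σ^N t^{N(N-1)/2} / (s_1 ⋯ s_N)) ∏_{i=1}^N (1 - (ab/σ) s_i)(1 - (cd/(qσ)) s_i)`,
one has `d̂_N = d_N + ∑_{m=1}^N (-1)^m (a^m b^m + c^m d^m q^{-m}) t^{m(m-1)/2} d_{N-m}`. -/
theorem rains_eigenvalue_relation {K : Type*} [Field K] (N : ℕ) (hN : 1 ≤ N)
    (a b c d q t σ : K) (ha : a ≠ 0) (hb : b ≠ 0) (hc : c ≠ 0) (hd : d ≠ 0)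
    (hq : q ≠ 0) (ht : t ≠ 0) (hσ : σ ≠ 0) (hσ2 : σ ^ 2 = a * b * c * d / q)
    (s : ℕ → K) (hs : ∀ i ∈ Finset.Icc 1 N, s i ≠ 0) :
    σ ^ N * t ^ (((N : ℤ) * ((N : ℤ) - 1)) / 2) / (∏ i ∈ Finset.Icc 1 N, s i) *
        ∏ i ∈ Finset.Icc 1 N, ((1 - a * b / σ * s i) * (1 - c * d / (q * σ) * s i)) =
      dKM N σ t s N +
        ∑ m ∈ Finset.Icc 1 N,
          (-1 : K) ^ m * (a ^ m * b ^ m + c ^ m * d ^ m * q ^ (-(m : ℤ))) *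
            t ^ (((m : ℤ) * ((m : ℤ) - 1)) / 2) * dKM N σ t s (N - m) := by
  obtain ⟨x, hxd⟩ : ∃ x, x = a * b / σ := ⟨_, rfl⟩
  have hx : x ≠ 0 := by rw [hxd]; exact div_ne_zero (mul_ne_zero ha hb) hσ
  have hab : a * b = σ * x := by rw [hxd]; field_simp
  have hcd : c * d * q⁻¹ = σ * x⁻¹ := by
    have h : σ * x * (c * d * q⁻¹) = σ ^ 2 := by rw [← hab, hσ2]; field_simp
    field_simp at h ⊢
    linear_combination h
  have hy : c * d / (q * σ) = x⁻¹ := by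
    have : c * d / (q * σ) = (c * d * q⁻¹) * σ⁻¹ := by field_simp
    rw [this, hcd]; field_simp
  have hcard : (Finset.Icc 1 N).card = N := by simp
  have hprod : (∏ i ∈ Finset.Icc 1 N, ((1 - x * s i) * (1 - x⁻¹ * s i))) =
      (∏ i ∈ Finset.Icc 1 N, s i) * ((-x)⁻¹ ^ N *
        ∏ i ∈ Finset.Icc 1 N, ((1 + (-x) * s i) * (1 + (-x) * (s i)⁻¹))) := by
    have h : (-x)⁻¹ ^ N = ∏ i ∈ Finset.Icc 1 N, (-x)⁻¹ := by simp
    rw [h, ← Finset.prod_mul_distrib, ← Finset.prod_mul_distrib]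
    refine Finset.prod_congr rfl fun i hi => ?_
    have := hs i hi
    rw [inv_neg]
    field_simp
    ring
  have hP : ∏ i ∈ Finset.Icc 1 N, s i ≠ 0 := Finset.prod_ne_zero_iff.2 hs
  have hnx : -x ≠ 0 := neg_ne_zero.2 hx
  rw [← hxd, hy, hprod, ← mul_assoc, div_mul_cancel₀ _ hP, ehatF_gen, hcard, sum_range_split,
    mul_add, mul_add, Finset.mul_sum, Finset.mul_sum]
  congr 1
  · have h := t_exp N 0 (Nat.zero_le N)
    simp only [Nat.cast_zero, zero_mul, Int.zero_ediv, zero_add, Nat.sub_zero] at h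
    rw [dKM, h, inv_pow, ← mul_assoc ((-x) ^ N)⁻¹, inv_mul_cancel₀ (pow_ne_zero _ hnx), one_mul]
  · refine Finset.sum_congr rfl fun m hm => ?_
    have hmN := (Finset.mem_Icc.1 hm).2
    have hsym := ehatF_symm (Finset.Icc 1 N) s hs m (by rw [hcard]; exact hmN)
    rw [hcard] at hsym
    have hc' : c ^ m * d ^ m * q ^ (-(m : ℤ)) = σ ^ m * (x⁻¹) ^ m := by
      rw [← mul_pow σ, ← hcd, zpow_neg, zpow_natCast, mul_pow, mul_pow, inv_pow]
    rw [hsym, dKM, hc', ← mul_pow, hab, ← t_exp N m hmN, zpow_add₀ ht]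
    generalize ehatF (N - m) (Finset.Icc 1 N) s = E
    generalize t ^ (((m : ℤ) * ((m : ℤ) - 1)) / 2) = T1
    generalize t ^ (((N - m : ℕ) : ℤ) * (N : ℤ) -
      (((N - m : ℕ) : ℤ) * (((N - m : ℕ) : ℤ) + 1)) / 2) = T2
    obtain ⟨k, rfl⟩ := Nat.exists_eq_add_of_le hmN
    rw [show m + k - m = k by omega]
    have e1 : (-x)⁻¹ ^ (m + k) * (-x) ^ k = (-1) ^ m * x⁻¹ ^ m := by
      rw [pow_add, mul_assoc, ← mul_pow, inv_mul_cancel₀ hnx, one_pow, mul_one, ← mul_pow,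
        inv_neg, neg_one_mul]
    have e2 : (-x)⁻¹ ^ (m + k) * (-x) ^ (m + k + m) = (-1) ^ m * x ^ m := by
      rw [pow_add (-x) (m + k) m, ← mul_assoc, ← mul_pow, inv_mul_cancel₀ hnx, one_pow, one_mul,
        ← mul_pow, neg_one_mul]
    rw [mul_pow, pow_add σ]
    linear_combination (σ ^ m * σ ^ k * T1 * T2 * E) * (e1 + e2)
end
end

section
/- Let N ≥ 1 and let F = ℚ(a, b, c, d, r, t, x_1, …, x_N) be the field of rational functions in N + 6 indeterminates over ℚ; set q := r². Then the following identity holds in F: Σ_{ε=±1} [ (1 − ε r^{−1} a)(1 − ε r^{−1} b)(1 − ε r^{−1} c)(1 − ε r^{−1} d) / (2 (1 − t)(1 − q^{−1} t)) ] · { ∏_{i=1}^N [ (1 − ε r^{−1} t x_i)/(1 − ε r^{−1} x_i) ] · [ (1 − ε r^{−1} t x_i^{−1})/(1 − ε r^{−1} x_i^{−1}) ] − t^N } = ((1 − t^N)/(1 − t)) · (1 + (abcd/q) t^{N−1}) − Σ_{i=1}^N Σ_{ε=±1} Φ_{i,ε}, where r plays the role of q^{1/2}. (This identifies the scalar part φ^{(a,b,c,d)}(x)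 of the first Koornwinder–Macdonald operator as the stated explicit rational function.) -/
open scoped BigOperators

noncomputable section

/-- The field `ℚ(a, b, c, d, r, t, x_1, …, x_N)` of rational functions in `N + 6`
indeterminates over `ℚ`. -/
abbrev KField (N : ℕ) : Type :=
  FractionRing (MvPolynomial (Fin 6 ⊕ Fin N) ℚ)

/-- The indeterminates of `ℚ(a, b, c, d, r, t, x_1, …, x_N)`. -/
noncomputable def gen (N : ℕ) (i : Fin 6 ⊕ Fin N) : KField N :=
  algebraMap (MvPolynomial (Fin 6 ⊕ Fin N) ℚ) (KField N) (MvPolynomial.X i)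

open Polynomial in
lemma kw_res_sum {K ι : Type*} [Field K] [Fintype ι] [DecidableEq ι] (v : ι → K)
    (hv : Function.Injective v) (P : K[X]) (hP : P.degree < Fintype.card ι) (c : K)
    (D : K[X]) (hD : D = C c * ∏ i, (X - C (v i))) (Q : ι → K[X])
    (hQ : ∀ i, D = (X - C (v i)) * Q i) :
    ∑ i, P.eval (v i) / (Q i).eval (v i) = P.coeff (Fintype.card ι - 1) / c := by
  have h := Lagrange.coeff_eq_sum (s := Finset.univ) (v := v) (hv.injOn) (P := P)
    (by simpa using hP)
  rw [Finset.card_univ] at h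
  rw [h, Finset.sum_div]
  refine Finset.sum_congr rfl fun i _ => ?_
  have : Q i = C c * ∏ j ∈ Finset.univ.erase i, (X - C (v j)) := by
    have h1 := hQ i
    rw [hD, ← Finset.mul_prod_erase Finset.univ _ (Finset.mem_univ i)] at h1
    have h2 : (X - C (v i)) ≠ 0 := X_sub_C_ne_zero _
    apply mul_left_cancel₀ h2
    rw [← h1]; ring
  rw [this, eval_mul, eval_C, eval_prod]
  simp only [eval_sub, eval_X, eval_C]
  rw [div_div, mul_comm]

open Polynomial in
/-- Numerator factor. -/
noncomputable def kwU {K : Type*} [Field K] (t x : K) : K[X] := (C t * X - C x) * (C (t * x) * X - 1)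

open Polynomial in
/-- Denominator factor. -/
noncomputable def kwV {K : Type*} [Field K] (x : K) : K[X] := (X - C x) * (C x * X - 1)

open Polynomial in
lemma kw_dvd {K ι : Type*} [Field K] (s : Finset ι) (t : K) (x : ι → K) :
    ∃ H : K[X], ∏ j ∈ s, kwU t (x j) - C (t ^ s.card) * ∏ j ∈ s, kwV (x j)
      = (1 - C t * X ^ 2) * H := by
  classical
  induction s using Finset.induction_on with
  | empty => exact ⟨0, by simp⟩
  | insert i s hi ih =>
    obtain ⟨H, hH⟩ := ih
    refine ⟨kwU t (x i) * H + C (t ^ s.card) * (∏ j ∈ s, kwV (x j)) * C (x i * (1 - t)), ?_⟩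
    rw [Finset.prod_insert hi, Finset.prod_insert hi, Finset.card_insert_of_notMem hi, mul_add]
    have e : kwU t (x i) - C t * kwV (x i) = (1 - C t * X ^ 2) * C (x i * (1 - t)) := by
      simp only [kwU, kwV, C_mul, C_sub, C_1]; ring
    have : C (t ^ (s.card + 1)) = C t * C (t ^ s.card) := by rw [← C_mul, pow_succ']
    rw [this]
    linear_combination kwU t (x i) * hH + C (t ^ s.card) * (∏ j ∈ s, kwV (x j)) * e

open Polynomial in
lemma kwU_natDegree {K : Type*} [Field K] (t x : K) : (kwU t x).natDegree ≤ 2 := by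
  unfold kwU; compute_degree

open Polynomial in
lemma kwV_natDegree {K : Type*} [Field K] (x : K) : (kwV x).natDegree ≤ 2 := by
  unfold kwV; compute_degree

open Polynomial in
lemma kwU_coeff {K : Type*} [Field K] (t x : K) : (kwU t x).coeff 2 = t ^ 2 * x := by
  unfold kwU
  rw [coeff_mul_add_eq_of_natDegree_le (df := 1) (dg := 1) (by compute_degree) (by compute_degree)]
  simp only [coeff_sub, coeff_C_mul, coeff_X_one, coeff_C_succ, coeff_one]
  norm_num
  ring

open Polynomial in
lemma kwV_coeff {K : Type*} [Field K] (x : K) : (kwV x).coeff 2 = x := by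
  unfold kwV
  rw [coeff_mul_add_eq_of_natDegree_le (df := 1) (dg := 1) (by compute_degree) (by compute_degree)]
  simp only [coeff_sub, coeff_C_mul, coeff_X_one, coeff_C_succ, coeff_one]
  norm_num

open Polynomial in
lemma kw_prod_coeff {K ι : Type*} [Field K] [Fintype ι] (f : ι → K[X])
    (hf : ∀ i, (f i).natDegree ≤ 2) :
    (∏ i, f i).natDegree ≤ 2 * Fintype.card ι ∧
    (∏ i, f i).coeff (2 * Fintype.card ι) = ∏ i, (f i).coeff 2 := by
  constructor
  · refine (natDegree_prod_le _ _).trans ?_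
    refine (Finset.sum_le_card_nsmul _ _ 2 fun i _ => hf i).trans ?_
    simp [mul_comm]
  · have := coeff_prod_of_natDegree_le Finset.univ f 2 (fun i _ => hf i)
    rw [← this, Finset.card_univ, mul_comm]

open Polynomial in
lemma kw_H {K ι : Type*} [Field K] [Fintype ι] (hN : 1 ≤ Fintype.card ι) (t : K) (ht : t ≠ 0)
    (x : ι → K) (H : K[X])
    (hH : ∏ j, kwU t (x j) - C (t ^ Fintype.card ι) * ∏ j, kwV (x j)
      = (1 - C t * X ^ 2) * H) :
    H.natDegree ≤ 2 * Fintype.card ι - 2 ∧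
    H.coeff (2 * Fintype.card ι - 2) =
      (t ^ (Fintype.card ι - 1) - t ^ (2 * Fintype.card ι - 1)) * ∏ j, x j := by
  obtain ⟨n, hn⟩ : ∃ n, Fintype.card ι = n + 1 := ⟨Fintype.card ι - 1, by omega⟩
  obtain ⟨u1, u2⟩ := kw_prod_coeff (fun i => kwU t (x i)) (fun i => kwU_natDegree t (x i))
  obtain ⟨v1, v2⟩ := kw_prod_coeff (fun i => kwV (x i)) (fun i => kwV_natDegree (x i))
  simp only [kwU_coeff, kwV_coeff, Finset.prod_mul_distrib, Finset.prod_const,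
    Finset.card_univ] at u2 v2
  have hL : ((1 - C t * X ^ 2) * H).natDegree ≤ 2 * Fintype.card ι := by
    rw [← hH]
    refine (natDegree_sub_le _ _).trans (max_le u1 ?_)
    exact (natDegree_C_mul_le _ _).trans v1
  have hd2 : (1 - C t * X ^ 2 : K[X]).natDegree = 2 := by compute_degree!
  have hne : (1 - C t * X ^ 2 : K[X]) ≠ 0 := by
    intro h; rw [h] at hd2; simp at hd2
  have hdeg : H.natDegree ≤ 2 * Fintype.card ι - 2 := by
    by_cases h0 : H = 0
    · simp [h0]
    rw [natDegree_mul hne h0, hd2] at hL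
    omega
  refine ⟨hdeg, ?_⟩
  have hc := congrArg (fun p => coeff p (2 * Fintype.card ι)) hH
  simp only [coeff_sub, coeff_C_mul, u2, v2, sub_mul, one_mul, mul_assoc] at hc
  rw [coeff_eq_zero_of_natDegree_lt (p := H) (by omega)] at hc
  rw [hn] at hc ⊢
  rw [show 2 * (n + 1) = 2 * n + 2 by ring, coeff_X_pow_mul] at hc
  rw [show 2 * (n + 1) - 2 = 2 * n by omega, show n + 1 - 1 = n by omega,
    show 2 * (n + 1) - 1 = 2 * n + 1 by omega]
  apply mul_left_cancel₀ ht
  linear_combination hc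

lemma kw_inj {K : Type*} [Field K] (N : ℕ) (r : K) (x : Fin N → K)
    (h2 : (2 : K) ≠ 0) (hr : r ≠ 0)
    (hx : ∀ i, x i ≠ 0) (hxx : ∀ i j, i ≠ j → x i - x j ≠ 0) (hxy : ∀ i j, x i * x j - 1 ≠ 0)
    (hrx : ∀ i, r * x i - 1 ≠ 0) (hrx' : ∀ i, r * x i + 1 ≠ 0)
    (hr1 : ∀ i, x i - r ≠ 0) (hr1' : ∀ i, x i + r ≠ 0) :
    Function.Injective
      (Sum.elim (Sum.elim x (fun i => (x i)⁻¹)) ![0, r⁻¹, -r⁻¹] :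
        (Fin N ⊕ Fin N) ⊕ Fin 3 → K) := by
  have hri : r⁻¹ ≠ 0 := inv_ne_zero hr
  have m1 := mul_inv_cancel₀ hr
  have k1 : ∀ i, x i - r⁻¹ ≠ 0 := fun i h => hrx i (by linear_combination r * h + m1)
  have k2 : ∀ i, x i + r⁻¹ ≠ 0 := fun i h => hrx' i (by linear_combination r * h - m1)
  have m2 : ∀ i, x i * (x i)⁻¹ = 1 := fun i => mul_inv_cancel₀ (hx i)
  have k3 : ∀ i, (x i)⁻¹ - r⁻¹ ≠ 0 := fun i h => hr1 i (by
    linear_combination -r * x i * h + r * m2 i - x i * m1)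
  have k4 : ∀ i, (x i)⁻¹ + r⁻¹ ≠ 0 := fun i h => hr1' i (by
    linear_combination r * x i * h - r * m2 i - x i * m1)
  have k5 : ∀ i j, x i - (x j)⁻¹ ≠ 0 := fun i j h => hxy i j (by
    linear_combination x j * h + m2 j)
  have k6 : ∀ i j, x i = x j → i = j := fun i j h => by
    by_contra hne; exact hxx i j hne (sub_eq_zero.mpr h)
  have k7 : r⁻¹ ≠ -r⁻¹ := fun h => mul_ne_zero h2 hri (by linear_combination h)
  have hinjF : Function.Injective (![0, r⁻¹, -r⁻¹] : Fin 3 → K) := by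
    clear k1 k2 k3 k4 k5 k6 hxx hxy hrx hrx' hr1 hr1' m2
    have k8 := k7.symm
    intro i j h
    fin_cases i <;> fin_cases j <;> simp [hr, hr.symm, k7, k8] at h ⊢
  refine Function.Injective.sumElim (Function.Injective.sumElim (fun i j h => k6 i j h)
    (fun i j h => k6 i j (inv_injective h)) (fun i j h => k5 i j (sub_eq_zero.mpr h))) hinjF ?_
  rintro (i | i) j h
  · fin_cases j
    · exact hx i h
    · exact k1 i (sub_eq_zero.mpr h)
    · exact k2 i (eq_neg_iff_add_eq_zero.mp h)
  · fin_cases j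
    · exact inv_ne_zero (hx i) h
    · exact k3 i (sub_eq_zero.mpr h)
    · exact k4 i (eq_neg_iff_add_eq_zero.mp h)

lemma kw_aux {K : Type*} [Field K] (A r t T W U H : K) (h2 : (2 : K) ≠ 0) (hr : r ≠ 0)
    (hqt : 1 - (r ^ 2)⁻¹ * t ≠ 0) (hW : W ≠ 0)
    (hH : U - T * W = (1 - t * r⁻¹ ^ 2) * H) :
    A * H / (r⁻¹ * (-r ^ 2 * (r⁻¹ + r⁻¹)) * W) =
      -(A / (2 * (1 - (r ^ 2)⁻¹ * t)) * (U / W - T)) := by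
  have e1 : r⁻¹ * (-r ^ 2 * (r⁻¹ + r⁻¹)) = -2 := by field_simp; ring
  have e2 : U / W - T = (1 - (r ^ 2)⁻¹ * t) * H / W := by
    rw [inv_pow] at hH
    rw [eq_div_iff hW, sub_mul, div_mul_cancel₀ _ hW, hH]; ring
  rw [e1, e2]
  generalize 1 - (r ^ 2)⁻¹ * t = z at *
  field_simp

lemma kw_final {K : Type*} [Field K] (N : ℕ) (hN : 1 ≤ N) (a b c d r t S1 S2 PX W1 W2 U1 U2 H1 H2 : K)
    (h2 : (2 : K) ≠ 0) (hr : r ≠ 0) (ht1 : 1 - t ≠ 0)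
    (hqt : 1 - (r ^ 2)⁻¹ * t ≠ 0) (hPX : PX ≠ 0) (hW1 : W1 ≠ 0) (hW2 : W2 ≠ 0)
    (hH1 : U1 - t ^ N * W1 = (1 - t * r⁻¹ ^ 2) * H1)
    (hH2 : U2 - t ^ N * W2 = (1 - t * (-r⁻¹) ^ 2) * H2)
    (key : (t - 1) * S1 + (t - 1) * S2 +
      ((1 - a * 0) * (1 - b * 0) * (1 - c * 0) * (1 - d * 0) * ((1 - t ^ N) * PX) /
            ((1 - r ^ 2 * 0 ^ 2) * PX) +
          (1 - a * r⁻¹) * (1 - b * r⁻¹) * (1 - c * r⁻¹) * (1 - d * r⁻¹) * H1 /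
            (r⁻¹ * (-r ^ 2 * (r⁻¹ + r⁻¹)) * W1) +
        (1 - a * -r⁻¹) * (1 - b * -r⁻¹) * (1 - c * -r⁻¹) * (1 - d * -r⁻¹) * H2 /
          (-r⁻¹ * (-r ^ 2 * (-r⁻¹ - r⁻¹)) * W2)) =
    a * b * c * d * ((t ^ (N - 1) - t ^ (2 * N - 1)) * PX) / (-r ^ 2 * PX)) :
    (1 - r⁻¹ * a) * (1 - r⁻¹ * b) * (1 - r⁻¹ * c) * (1 - r⁻¹ * d) /
        (2 * (1 - t) * (1 - (r ^ 2)⁻¹ * t)) * (U1 / W1 - t ^ N) +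
      (1 - -r⁻¹ * a) * (1 - -r⁻¹ * b) * (1 - -r⁻¹ * c) * (1 - -r⁻¹ * d) /
        (2 * (1 - t) * (1 - (r ^ 2)⁻¹ * t)) * (U2 / W2 - t ^ N) =
    (1 - t ^ N) / (1 - t) * (1 + a * b * c * d / r ^ 2 * t ^ (N - 1)) - (S1 + S2) := by
  rw [neg_sq] at hH2
  have e : -r⁻¹ * (-r ^ 2 * (-r⁻¹ - r⁻¹)) = r⁻¹ * (-r ^ 2 * (r⁻¹ + r⁻¹)) := by ring
  rw [e, kw_aux _ r t _ W1 U1 H1 h2 hr hqt hW1 hH1, kw_aux _ r t _ W2 U2 H2 h2 hr hqt hW2 hH2] at key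
  have e0 : (1 - a * 0) * (1 - b * 0) * (1 - c * 0) * (1 - d * 0) * ((1 - t ^ N) * PX) /
            ((1 - r ^ 2 * 0 ^ 2) * PX) = 1 - t ^ N := by
    field_simp; ring
  obtain ⟨n, rfl⟩ : ∃ n, N = n + 1 := ⟨N - 1, by omega⟩
  rw [show n + 1 - 1 = n by omega, show 2 * (n + 1) - 1 = 2 * n + 1 by omega] at *
  have e3 : a * b * c * d * ((t ^ n - t ^ (2 * n + 1)) * PX) / (-r ^ 2 * PX) =
      -(a * b * c * d / r ^ 2 * t ^ n) * (1 - t ^ (n + 1)) := by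
    field_simp; ring
  rw [e0, e3] at key
  have e4 : ∀ A, A / (2 * (1 - t) * (1 - (r ^ 2)⁻¹ * t)) =
      A / (2 * (1 - (r ^ 2)⁻¹ * t)) / (1 - t) := fun A => by
    rw [div_div]; ring
  rw [e4, e4]
  apply mul_left_cancel₀ ht1
  rw [mul_add, mul_sub (1 - t) (_ * _) (S1 + S2)]
  have e5 : ∀ A B : K, (1 - t) * (A / (1 - t) * B) = A * B := fun A B => by
    rw [← mul_assoc, mul_div_cancel₀ _ ht1]
  rw [e5, e5, e5]
  rw [mul_comm r⁻¹ a, mul_comm r⁻¹ b, mul_comm r⁻¹ c, mul_comm r⁻¹ d, mul_comm (-r⁻¹) a,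
    mul_comm (-r⁻¹) b, mul_comm (-r⁻¹) c, mul_comm (-r⁻¹) d]
  linear_combination -key

set_option maxHeartbeats 1000000 in
open Polynomial in
lemma kw_general {K : Type*} [Field K] (N : ℕ) (hN : 1 ≤ N) (a b c d r t : K) (x : Fin N → K)
    (h2 : (2 : K) ≠ 0) (hr : r ≠ 0) (ht : t ≠ 0) (ht1 : 1 - t ≠ 0) (hqt : r ^ 2 - t ≠ 0)
    (hx : ∀ i, x i ≠ 0) (hxx : ∀ i j, i ≠ j → x i - x j ≠ 0) (hxy : ∀ i j, x i * x j - 1 ≠ 0)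
    (hrx : ∀ i, r * x i - 1 ≠ 0) (hrx' : ∀ i, r * x i + 1 ≠ 0)
    (hr1 : ∀ i, x i - r ≠ 0) (hr1' : ∀ i, x i + r ≠ 0)
    (htx : ∀ i, 1 - t * x i ^ 2 ≠ 0) (htx' : ∀ i, x i ^ 2 - t ≠ 0) :
     ∑ ε ∈ ({1, -1} : Finset ℤ),
        (1 - (ε : K) * r⁻¹ * a) * (1 - (ε : K) * r⁻¹ * b) *
            (1 - (ε : K) * r⁻¹ * c) * (1 - (ε : K) * r⁻¹ * d) /
            (2 * (1 - t) * (1 - (r ^ 2)⁻¹ * t)) *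
          ((∏ i : Fin N,
              ((1 - (ε : K) * r⁻¹ * t * x i) / (1 - (ε : K) * r⁻¹ * x i)) *
                ((1 - (ε : K) * r⁻¹ * t * (x i)⁻¹) /
                  (1 - (ε : K) * r⁻¹ * (x i)⁻¹))) -
            t ^ N) =
       (1 - t ^ N) / (1 - t) * (1 + a * b * c * d / r ^ 2 * t ^ (N - 1)) -
         ∑ i : Fin N, ∑ ε ∈ ({1, -1} : Finset ℤ),
           (1 - a * x i ^ ε) * (1 - b * x i ^ ε) * (1 - c * x i ^ ε) * (1 - d * x i ^ ε) /
               ((1 - x i ^ (2 * ε)) * (1 - r ^ 2 * x i ^ (2 * ε))) *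
             ∏ j ∈ Finset.univ.erase i,
               ((t * x i ^ ε - x j) / (x i ^ ε - x j)) *
                 ((t * x i ^ ε * x j - 1) / (x i ^ ε * x j - 1)) := by
  obtain ⟨H, hH⟩ := kw_dvd Finset.univ t x
  rw [Finset.card_univ] at hH
  obtain ⟨hHd, hHc⟩ := kw_H (by simpa using hN) t ht x H hH
  rw [Fintype.card_fin] at hHd hHc hH
  have hHe : ∀ z : K, ∏ j, ((t * z - x j) * (t * x j * z - 1))
      - t ^ N * ∏ j, ((z - x j) * (x j * z - 1)) = (1 - t * z ^ 2) * H.eval z := by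
    intro z
    have := congrArg (eval z) hH
    simpa [kwU, kwV, eval_prod] using this
  set A : K[X] := (1 - C a * X) * (1 - C b * X) * (1 - C c * X) * (1 - C d * X) with hA
  have hAd : A.natDegree ≤ 4 := by rw [hA]; compute_degree
  have hAc : A.coeff 4 = a * b * c * d := by
    have e : ∀ u : K, (1 - C u * X : K[X]).natDegree ≤ 1 := fun u => by compute_degree
    have e2 : ∀ u v : K, ((1 - C u * X) * (1 - C v * X) : K[X]).natDegree ≤ 2 :=
      fun u v => by compute_degree
    have e1 : ∀ u v : K, ((1 - C u * X) * (1 - C v * X) : K[X]).coeff 2 = u * v := by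
      intro u v
      rw [coeff_mul_add_eq_of_natDegree_le (df := 1) (dg := 1) (e u) (e v)]
      simp [coeff_one]
    rw [hA, mul_assoc ((1 - C a * X) * (1 - C b * X)),
      coeff_mul_add_eq_of_natDegree_le (df := 2) (dg := 2) (e2 a b) (e2 c d), e1, e1]
    ring
  have hPx : ∏ j, x j ≠ 0 := Finset.prod_ne_zero_iff.mpr fun i _ => hx i
  let v : (Fin N ⊕ Fin N) ⊕ Fin 3 → K :=
    Sum.elim (Sum.elim x (fun i => (x i)⁻¹)) ![0, r⁻¹, -r⁻¹]
  have hv : Function.Injective v := by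
    exact kw_inj N r x h2 hr hx hxx hxy hrx hrx' hr1 hr1'
  let E : Fin N → K[X] := fun i => ∏ j ∈ Finset.univ.erase i, kwV (x j)
  let W : K[X] := ∏ j, kwV (x j)
  have hWE : ∀ i, W = kwV (x i) * E i := fun i =>
    (Finset.mul_prod_erase Finset.univ (fun j => kwV (x j)) (Finset.mem_univ i)).symm
  let D : K[X] := X * (1 - C (r ^ 2) * X ^ 2) * W
  let Q : (Fin N ⊕ Fin N) ⊕ Fin 3 → K[X] :=
    Sum.elim (Sum.elim (fun i => X * (1 - C (r ^ 2) * X ^ 2) * (C (x i) * X - 1) * E i)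
      (fun i => X * (1 - C (r ^ 2) * X ^ 2) * (X - C (x i)) * C (x i) * E i))
      ![(1 - C (r ^ 2) * X ^ 2) * W, X * (C (-r ^ 2) * (X + C r⁻¹)) * W,
        X * (C (-r ^ 2) * (X - C r⁻¹)) * W]
  have hxC : ∀ i, (C (x i) * X - 1 : K[X]) = (X - C (x i)⁻¹) * C (x i) := by
    intro i
    rw [sub_mul, ← C_mul, inv_mul_cancel₀ (hx i), C_1]; ring
  have hqC : (1 - C (r ^ 2) * X ^ 2 : K[X]) = C (-r ^ 2) * (X - C r⁻¹) * (X + C r⁻¹) := by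
    have : (C (r ^ 2) * (C r⁻¹) ^ 2 : K[X]) = 1 := by
      rw [← C_pow, ← C_mul, ← mul_pow, mul_inv_cancel₀ hr]; simp
    rw [C_neg]
    linear_combination -this
  have key := kw_res_sum v hv (A * H) (by
      refine lt_of_le_of_lt degree_le_natDegree ?_
      have := natDegree_mul_le (p := A) (q := H)
      have h3 : Fintype.card ((Fin N ⊕ Fin N) ⊕ Fin 3) = N + N + 3 := by simp
      rw [h3]
      exact_mod_cast (by omega : (A * H).natDegree < N + N + 3))
    (-r ^ 2 * ∏ j, x j) D (by
      simp only [D, W, v, Fintype.prod_sum_type, Fin.prod_univ_three, Sum.elim_inl, Sum.elim_inr,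
        kwV, hxC, hqC, Finset.prod_mul_distrib, map_mul, map_prod]
      simp
      ring) Q (by
      rintro ((i | i) | i)
      · simp only [D, Q, v, Sum.elim_inl, hWE i, kwV]; ring
      · simp only [D, Q, v, Sum.elim_inl, Sum.elim_inr, hWE i, kwV, hxC]; ring
      · fin_cases i
        · simp [D, Q, v]; ring
        · change X * (1 - C (r ^ 2) * X ^ 2) * W =
            (X - C r⁻¹) * (X * (C (-r ^ 2) * (X + C r⁻¹)) * W)
          rw [hqC]; ring
        · change X * (1 - C (r ^ 2) * X ^ 2) * W =
            (X - C (-r⁻¹)) * (X * (C (-r ^ 2) * (X - C r⁻¹)) * W)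
          rw [hqC, C_neg (a := r⁻¹)]; ring)
  have hcard : Fintype.card ((Fin N ⊕ Fin N) ⊕ Fin 3) - 1 = 4 + (2 * N - 2) := by
    simp; omega
  rw [hcard, coeff_mul_add_eq_of_natDegree_le hAd hHd, hAc, hHc] at key
  have hAe : ∀ z, A.eval z = (1 - a * z) * (1 - b * z) * (1 - c * z) * (1 - d * z) := by
    intro z; simp [hA]
  simp only [Fintype.sum_sum_type, Fin.sum_univ_three, v, Q, Sum.elim_inl, Sum.elim_inr,
    eval_mul, hAe] at key
  have hEe : ∀ i z, (E i).eval z = ∏ j ∈ Finset.univ.erase i, ((z - x j) * (x j * z - 1)) := by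
    intro i z; simp [E, kwV, eval_prod]
  have hWe : ∀ z, W.eval z = ∏ j, ((z - x j) * (x j * z - 1)) := by
    intro z; simp [W, kwV, eval_prod]
  -- products as quotients
  have hprod : ∀ (s : Finset (Fin N)) (z : K), ∏ j ∈ s, ((t * z - x j) / (z - x j)) *
                 ((t * z * x j - 1) / (z * x j - 1)) =
      (∏ j ∈ s, ((t * z - x j) * (t * x j * z - 1))) / ∏ j ∈ s, ((z - x j) * (x j * z - 1)) := by
    intro s z
    rw [← Finset.prod_div_distrib]
    refine Finset.prod_congr rfl fun j _ => ?_
    rw [div_mul_div_comm, mul_right_comm t z, mul_comm z (x j)]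
  have hsplit : ∀ i z, (z - x i) * (x i * z - 1) = 0 →
      ((t * z - x i) * (t * x i * z - 1)) *
        ∏ j ∈ Finset.univ.erase i, ((t * z - x j) * (t * x j * z - 1)) =
        (1 - t * z ^ 2) * H.eval z := by
    intro i z hz
    rw [← hHe z, Finset.mul_prod_erase Finset.univ
      (fun j => (t * z - x j) * (t * x j * z - 1)) (Finset.mem_univ i),
      Finset.prod_eq_zero (f := fun j => (z - x j) * (x j * z - 1)) (Finset.mem_univ i) hz]
    ring
  have T1 : ∀ i, (1 - a * x i) * (1 - b * x i) * (1 - c * x i) * (1 - d * x i) * eval (x i) H /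
      (eval (x i) X * eval (x i) (1 - C (r ^ 2) * X ^ 2) * eval (x i) (C (x i) * X - 1) *
        eval (x i) (E i)) = (t - 1) *
      ((1 - a * x i) * (1 - b * x i) * (1 - c * x i) * (1 - d * x i) /
               ((1 - x i ^ 2) * (1 - r ^ 2 * x i ^ 2)) *
             ∏ j ∈ Finset.univ.erase i,
               ((t * x i - x j) / (x i - x j)) *
                 ((t * x i * x j - 1) / (x i * x j - 1))) := by
    intro i
    rw [hprod, hEe]
    have hs := hsplit i (x i) (by ring)
    have hne : ∏ j ∈ Finset.univ.erase i, ((x i - x j) * (x j * x i - 1)) ≠ 0 :=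
      Finset.prod_ne_zero_iff.mpr fun j hj =>
        mul_ne_zero (hxx i j (Finset.ne_of_mem_erase hj).symm) (hxy j i)
    set PU := ∏ j ∈ Finset.univ.erase i, ((t * x i - x j) * (t * x j * x i - 1))
    set PV := ∏ j ∈ Finset.univ.erase i, ((x i - x j) * (x j * x i - 1))
    have hH' : H.eval (x i) = (1 - t) * x i * PU := by
      apply mul_left_cancel₀ (htx i)
      rw [← hs]; ring
    rw [hH']
    simp only [eval_sub, eval_mul, eval_X, eval_C, eval_one, eval_pow]
    have n1 := hx i
    have n2 : x i ^ 2 - 1 ≠ 0 := by have := hxy i i; rwa [← sq] at this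
    have n2' : 1 - x i ^ 2 ≠ 0 := by intro h; apply n2; linear_combination -h
    have n3 : 1 - r ^ 2 * x i ^ 2 ≠ 0 := by
      intro h; apply mul_ne_zero (hrx i) (hrx' i); linear_combination -h
    have e : x i * x i - 1 = - (1 - x i ^ 2) := by ring
    rw [e]
    field_simp
    ring
  have T2 : ∀ i, (1 - a * (x i)⁻¹) * (1 - b * (x i)⁻¹) * (1 - c * (x i)⁻¹) * (1 - d * (x i)⁻¹) *
        eval (x i)⁻¹ H /
      (eval (x i)⁻¹ X * eval (x i)⁻¹ (1 - C (r ^ 2) * X ^ 2) * eval (x i)⁻¹ (X - C (x i)) *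
        eval (x i)⁻¹ (C (x i)) * eval (x i)⁻¹ (E i)) = (t - 1) *
      ((1 - a * (x i)⁻¹) * (1 - b * (x i)⁻¹) * (1 - c * (x i)⁻¹) * (1 - d * (x i)⁻¹) /
               ((1 - ((x i) ^ 2)⁻¹) * (1 - r ^ 2 * (x i ^ 2)⁻¹)) *
             ∏ j ∈ Finset.univ.erase i,
               ((t * (x i)⁻¹ - x j) / ((x i)⁻¹ - x j)) *
                 ((t * (x i)⁻¹ * x j - 1) / ((x i)⁻¹ * x j - 1))) := by
    intro i
    have n1 := hx i
    rw [hprod, hEe]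
    have hs := hsplit i (x i)⁻¹ (by rw [mul_inv_cancel₀ n1]; ring)
    have hne : ∏ j ∈ Finset.univ.erase i, (((x i)⁻¹ - x j) * (x j * (x i)⁻¹ - 1)) ≠ 0 := by
      refine Finset.prod_ne_zero_iff.mpr fun j hj => mul_ne_zero ?_ ?_
      · intro h
        apply hxy i j
        have := mul_inv_cancel₀ n1
        linear_combination this - x i * h
      · intro h
        apply hxx j i (Finset.ne_of_mem_erase hj)
        have := mul_inv_cancel₀ n1
        linear_combination x i * h - x j * this
    set PU := ∏ j ∈ Finset.univ.erase i, ((t * (x i)⁻¹ - x j) * (t * x j * (x i)⁻¹ - 1))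
    set PV := ∏ j ∈ Finset.univ.erase i, (((x i)⁻¹ - x j) * (x j * (x i)⁻¹ - 1))
    have hH' : H.eval (x i)⁻¹ = (1 - t) * x i * PU := by
      have h0 : 1 - t * (x i)⁻¹ ^ 2 ≠ 0 := by
        intro h
        apply htx' i
        have := mul_inv_cancel₀ n1
        field_simp at h
        linear_combination h
      apply mul_left_cancel₀ h0
      rw [← hs]; field_simp; ring
    rw [hH']
    simp only [eval_sub, eval_mul, eval_X, eval_C, eval_one, eval_pow]
    have n2 : x i ^ 2 - 1 ≠ 0 := by have := hxy i i; rwa [← sq] at this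
    have n3 : x i ^ 2 - r ^ 2 ≠ 0 := by
      intro h; apply mul_ne_zero (hr1 i) (hr1' i); linear_combination h
    have e1 : (x i)⁻¹ - x i = - (x i ^ 2 - 1) / x i := by field_simp; ring
    have e2 : 1 - r ^ 2 * (x i)⁻¹ ^ 2 = (x i ^ 2 - r ^ 2) / x i ^ 2 := by field_simp
    have e3 : 1 - r ^ 2 * (x i ^ 2)⁻¹ = (x i ^ 2 - r ^ 2) / x i ^ 2 := by field_simp
    have e4 : 1 - (x i ^ 2)⁻¹ = (x i ^ 2 - 1) / x i ^ 2 := by field_simp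
    rw [e1, e2, e3, e4]
    field_simp
    ring
  have hprod2 : ∀ (z : K), ∏ j, ((1 - z * t * x j) / (1 - z * x j)) *
                 ((1 - z * t * (x j)⁻¹) / (1 - z * (x j)⁻¹)) =
      (∏ j, ((t * z - x j) * (t * x j * z - 1))) / ∏ j, ((z - x j) * (x j * z - 1)) := by
    intro z
    rw [← Finset.prod_div_distrib]
    refine Finset.prod_congr rfl fun j _ => ?_
    rw [div_mul_div_comm]
    have e1 : (t * z - x j) * (t * x j * z - 1) =
      x j * ((1 - z * t * x j) * (1 - z * t * (x j)⁻¹)) := by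
      have := hx j
      field_simp; ring
    have e2 : (z - x j) * (x j * z - 1) =
      x j * ((1 - z * x j) * (1 - z * (x j)⁻¹)) := by
      have := hx j
      field_simp; ring
    rw [e1, e2, mul_div_mul_left _ _ (hx j)]
  have hW1 : ∏ j, ((r⁻¹ - x j) * (x j * r⁻¹ - 1)) ≠ 0 := by
    refine Finset.prod_ne_zero_iff.mpr fun j hj => mul_ne_zero ?_ ?_
    · intro h; apply hrx j
      have := mul_inv_cancel₀ hr
      linear_combination this - r * h
    · intro h; apply hr1 j
      have := mul_inv_cancel₀ hr
      linear_combination r * h - x j * this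
  have hW2 : ∏ j, ((-r⁻¹ - x j) * (x j * -r⁻¹ - 1)) ≠ 0 := by
    refine Finset.prod_ne_zero_iff.mpr fun j hj => mul_ne_zero ?_ ?_
    · intro h; apply hrx' j
      have := mul_inv_cancel₀ hr
      linear_combination -this - r * h
    · intro h; apply hr1' j
      have := mul_inv_cancel₀ hr
      linear_combination -r * h - x j * this
  have hqt' : 1 - (r ^ 2)⁻¹ * t ≠ 0 := by
    intro h; apply hqt
    field_simp at h
    linear_combination h
  have hH1 := hHe r⁻¹
  have hH2 := hHe (-r⁻¹)
  have hH0 : H.eval 0 = (1 - t ^ N) * ∏ j, x j := by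
    have := hHe 0
    simp at this
    rw [← this]; ring
  have S1 : ∑ i, (1 - a * x i) * (1 - b * x i) * (1 - c * x i) * (1 - d * x i) * eval (x i) H /
      (eval (x i) X * eval (x i) (1 - C (r ^ 2) * X ^ 2) * eval (x i) (C (x i) * X - 1) *
        eval (x i) (E i)) = _ := Finset.sum_congr rfl fun i _ => T1 i
  have S2 : ∑ i, (1 - a * (x i)⁻¹) * (1 - b * (x i)⁻¹) * (1 - c * (x i)⁻¹) * (1 - d * (x i)⁻¹) *
        eval (x i)⁻¹ H /
      (eval (x i)⁻¹ X * eval (x i)⁻¹ (1 - C (r ^ 2) * X ^ 2) * eval (x i)⁻¹ (X - C (x i)) *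
        eval (x i)⁻¹ (C (x i)) * eval (x i)⁻¹ (E i)) = _ := Finset.sum_congr rfl fun i _ => T2 i
  rw [S1, S2, ← Finset.mul_sum, ← Finset.mul_sum] at key
  simp only [Finset.sum_pair (show (1 : ℤ) ≠ -1 by decide), Int.cast_one, Int.cast_neg, one_mul,
    zpow_one, mul_one, zpow_neg, mul_neg, neg_mul, Finset.sum_add_distrib]
  simp only [← neg_mul, zpow_ofNat]
  rw [hprod2, hprod2]
  simp only [Matrix.cons_val_zero, Matrix.cons_val_one, Matrix.cons_val, hWe, hH0, eval_mul, eval_add, eval_sub, eval_X, eval_C, eval_one, eval_pow] at key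
  clear T1 T2 S1 S2
  have hW0 : ∏ j, (0 - x j) * (x j * 0 - 1) = ∏ j, x j :=
    Finset.prod_congr rfl fun j _ => by ring
  rw [hW0] at key
  refine kw_final N hN a b c d r t _ _ (∏ j, x j) _ _ _ _ _ _ h2 hr ht1 hqt' hPx hW1 hW2 hH1 hH2 ?_
  exact key

lemma kw_ne (N : ℕ) (p : MvPolynomial (Fin 6 ⊕ Fin N) ℚ)
    (h : MvPolynomial.eval (Sum.elim ![0, 0, 0, 0, 2, 3] (fun i : Fin N => (5 + (i : ℕ) : ℚ))) p ≠ 0) :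
    algebraMap (MvPolynomial (Fin 6 ⊕ Fin N) ℚ) (KField N) p ≠ 0 := by
  intro h0
  rw [map_eq_zero_iff _ (IsFractionRing.injective _ _)] at h0
  rw [h0] at h
  simp at h

/-- The constant-term identity for the first Koornwinder–Macdonald operator: in
`F = ℚ(a,b,c,d,r,t,x_1,…,x_N)` with `q = r²` (so `r` plays the role of `q^{1/2}`),
`∑_{ε=±1} [(1 - εr⁻¹a)(1 - εr⁻¹b)(1 - εr⁻¹c)(1 - εr⁻¹d)/(2(1-t)(1-q⁻¹t))] ·
  {∏_{i=1}^N [(1 - εr⁻¹ t x_i)/(1 - εr⁻¹ x_i)][(1 - εr⁻¹ t x_i⁻¹)/(1 - εr⁻¹ x_i⁻¹)] - t^N}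
 = ((1 - t^N)/(1 - t))(1 + (abcd/q) t^{N-1}) - ∑_{i=1}^N ∑_{ε=±1} Φ_{i,ε}`,
where `Φ_{i,ε}` are the Koornwinder coefficient functions. -/
theorem koornwinder_constant_term (N : ℕ) (hN : 1 ≤ N) :
    (let a : KField N := gen N (Sum.inl 0)
     let b : KField N := gen N (Sum.inl 1)
     let c : KField N := gen N (Sum.inl 2)
     let d : KField N := gen N (Sum.inl 3)
     let r : KField N := gen N (Sum.inl 4)
     let t : KField N := gen N (Sum.inl 5)
     let q : KField N := r ^ 2
     let x : Fin N → KField N := fun i => gen N (Sum.inr i)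
     ∑ ε ∈ ({1, -1} : Finset ℤ),
        (1 - (ε : KField N) * r⁻¹ * a) * (1 - (ε : KField N) * r⁻¹ * b) *
            (1 - (ε : KField N) * r⁻¹ * c) * (1 - (ε : KField N) * r⁻¹ * d) /
            (2 * (1 - t) * (1 - q⁻¹ * t)) *
          ((∏ i : Fin N,
              ((1 - (ε : KField N) * r⁻¹ * t * x i) / (1 - (ε : KField N) * r⁻¹ * x i)) *
                ((1 - (ε : KField N) * r⁻¹ * t * (x i)⁻¹) /
                  (1 - (ε : KField N) * r⁻¹ * (x i)⁻¹))) -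
            t ^ N)) =
      (let a : KField N := gen N (Sum.inl 0)
       let b : KField N := gen N (Sum.inl 1)
       let c : KField N := gen N (Sum.inl 2)
       let d : KField N := gen N (Sum.inl 3)
       let r : KField N := gen N (Sum.inl 4)
       let t : KField N := gen N (Sum.inl 5)
       let q : KField N := r ^ 2
       let x : Fin N → KField N := fun i => gen N (Sum.inr i)
       (1 - t ^ N) / (1 - t) * (1 + a * b * c * d / q * t ^ (N - 1)) -
         ∑ i : Fin N, ∑ ε ∈ ({1, -1} : Finset ℤ),
           (1 - a * x i ^ ε) * (1 - b * x i ^ ε) * (1 - c * x i ^ ε) * (1 - d * x i ^ ε) /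
               ((1 - x i ^ (2 * ε)) * (1 - q * x i ^ (2 * ε))) *
             ∏ j ∈ Finset.univ.erase i,
               ((t * x i ^ ε - x j) / (x i ^ ε - x j)) *
                 ((t * x i ^ ε * x j - 1) / (x i ^ ε * x j - 1))) := by
  have p : ∀ i : Fin N, (0 : ℚ) ≤ ((i : ℕ) : ℚ) := fun i => Nat.cast_nonneg _
  refine kw_general N hN _ _ _ _ _ _ _ two_ne_zero ?_ ?_ ?_ ?_ ?_ ?_ ?_ ?_ ?_ ?_ ?_ ?_ ?_
  · exact kw_ne N (.X (Sum.inl 4)) (by simp)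
  · exact kw_ne N (.X (Sum.inl 5)) (by simp)
  · simpa [gen] using kw_ne N (1 - .X (Sum.inl 5)) (by simp; norm_num)
  · simpa only [gen, map_sub, map_mul, sq] using
      kw_ne N (.X (Sum.inl 4) * .X (Sum.inl 4) - .X (Sum.inl 5)) (by simp; norm_num)
  · intro i
    exact kw_ne N (.X (Sum.inr i)) (by simp; have := p i; positivity)
  · intro i j hij
    simpa only [gen, map_sub] using kw_ne N (.X (Sum.inr i) - .X (Sum.inr j)) (by
      simp [sub_eq_zero]; omega)
  · intro i j
    simpa only [gen, map_sub, map_mul, map_one] using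
      kw_ne N (.X (Sum.inr i) * .X (Sum.inr j) - 1) (by
      simp; have := p i; have := p j; apply ne_of_gt; nlinarith)
  · intro i
    simpa only [gen, map_sub, map_mul, map_one] using
      kw_ne N (.X (Sum.inl 4) * .X (Sum.inr i) - 1) (by
      simp; have := p i; apply ne_of_gt; linarith)
  · intro i
    simpa only [gen, map_add, map_mul, map_one] using
      kw_ne N (.X (Sum.inl 4) * .X (Sum.inr i) + 1) (by
      simp; have := p i; apply ne_of_gt; linarith)
  · intro i
    simpa only [gen, map_sub] using
      kw_ne N (.X (Sum.inr i) - .X (Sum.inl 4)) (by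
      simp; have := p i; apply ne_of_gt; linarith)
  · intro i
    simpa only [gen, map_add] using
      kw_ne N (.X (Sum.inr i) + .X (Sum.inl 4)) (by
      simp; have := p i; apply ne_of_gt; linarith)
  · intro i
    simpa only [gen, map_sub, map_mul, sq, map_one] using
      kw_ne N (1 - .X (Sum.inl 5) * (.X (Sum.inr i) * .X (Sum.inr i))) (by
      simp; have := p i; apply ne_of_lt; nlinarith)
  · intro i
    simpa only [gen, map_sub, map_mul, sq] using
      kw_ne N (.X (Sum.inr i) * .X (Sum.inr i) - .X (Sum.inl 5)) (by
      simp; have := p i; apply ne_of_gt; nlinarith)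
end
end

section
/- Let N ≥ 2 and q ∈ ℂ∖{0}. On the ℂ-vector space of functions f : ℤ^N → ℂ, define the operators (Λ_i f)(λ) = q^{λ_i} f(λ) and (T_i^{±1} f)(λ) = f(λ ± e_i), and let H_1 := T_1 + Σ_{i=2}^N (1 − Λ_i Λ_{i−1}^{−1}) T_i + Σ_{i=1}^{N−1} (1 − Λ_{i+1} Λ_i^{−1}) T_i^{−1} + (1 − Λ_N^{−1}) T_N^{−1} be the first q-Whittaker Pieri operator (q-difference Toda Hamiltonian) of type C_N^{(1)}, where a rational expression in the Λ's denotes the corresponding multiplication operator placed to the left of the shift. Then H_1 ∘ Λ_1 − Λ_1 ∘ H_1 = (q − 1)·Λ_1 T_1 + (q^{−1} − 1)·(Λ_1 − Λ_2) T_1^{−1}, i.e. the commutator [H_1, Λ_1] equals (q−1) D̄_{1;1} + (q^{−1}−1) D̄_{1;−1}, where D̄_{1;1} = Λ_1 T_1 and D̄_{1;−1} = (Λ_1 − Λ_2) T_1^{−1} are the Fourier-transformed translated first Macdonald operators. -/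
open scoped BigOperators

noncomputable section

/-- The shift operator `T_i^e` on functions of `λ ∈ ℤ^ℕ`: `(T_i^e f)(λ) = f(λ + e·δ_i)`. -/
noncomputable def shiftOp (i : ℕ) (e : ℤ) (f : (ℕ → ℤ) → ℂ) : (ℕ → ℤ) → ℂ :=
  fun lam => f fun j => lam j + if j = i then e else 0

/-- The multiplication operator `Λ_i`: `(Λ_i f)(λ) = q^{λ_i} f(λ)`. -/
noncomputable def lamOp (q : ℂ) (i : ℕ) (f : (ℕ → ℤ) → ℂ) : (ℕ → ℤ) → ℂ :=
  fun lam => q ^ lam i * f lam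

/-- The first q-Whittaker Pieri operator (q-difference Toda Hamiltonian) of type
`C_N^{(1)}`:
`H_1 = T_1 + ∑_{i=2}^N (1 - Λ_i Λ_{i-1}⁻¹) T_i + ∑_{i=1}^{N-1} (1 - Λ_{i+1} Λ_i⁻¹) T_i⁻¹
  + (1 - Λ_N⁻¹) T_N⁻¹`,
rational expressions in the `Λ`'s denoting multiplication operators placed to the left of
the shifts. -/
noncomputable def todaC (N : ℕ) (q : ℂ) (f : (ℕ → ℤ) → ℂ) : (ℕ → ℤ) → ℂ :=
  fun lam =>
    shiftOp 1 1 f lam +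
      (∑ i ∈ Finset.Icc 2 N, (1 - q ^ lam i * (q ^ lam (i - 1))⁻¹) * shiftOp i 1 f lam) +
      (∑ i ∈ Finset.Icc 1 (N - 1),
        (1 - q ^ lam (i + 1) * (q ^ lam i)⁻¹) * shiftOp i (-1) f lam) +
      (1 - (q ^ lam N)⁻¹) * shiftOp N (-1) f lam

/-- The commutator of the type-`C_N^{(1)}` q-difference Toda Hamiltonian with `Λ_1`:
`[H_1, Λ_1] = (q - 1) Λ_1 T_1 + (q⁻¹ - 1)(Λ_1 - Λ_2) T_1⁻¹`,
i.e. `[H_1, Λ_1] = (q-1) D̄_{1;1} + (q⁻¹-1) D̄_{1;-1}` with `D̄_{1;1} = Λ_1 T_1` and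
`D̄_{1;-1} = (Λ_1 - Λ_2) T_1⁻¹` the Fourier-transformed translated first Macdonald
operators. -/
theorem toda_commutator_C (N : ℕ) (hN : 2 ≤ N) (q : ℂ) (hq : q ≠ 0)
    (f : (ℕ → ℤ) → ℂ) (lam : ℕ → ℤ) :
    todaC N q (lamOp q 1 f) lam - lamOp q 1 (todaC N q f) lam =
      (q - 1) * (q ^ lam 1 * shiftOp 1 1 f lam) +
        (q⁻¹ - 1) * ((q ^ lam 1 - q ^ lam 2) * shiftOp 1 (-1) f lam) := by
  have h1 : ∀ (i : ℕ) (e : ℤ), i ≠ 1 →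
      shiftOp i e (lamOp q 1 f) lam = q ^ lam 1 * shiftOp i e f lam := by
    intro i e hi
    simp [shiftOp, lamOp, Ne.symm hi]
  have h2 : ∀ e : ℤ,
      shiftOp 1 e (lamOp q 1 f) lam = q ^ e * (q ^ lam 1 * shiftOp 1 e f lam) := by
    intro e
    simp only [shiftOp, lamOp, if_true, zpow_add₀ hq]
    ring
  have hs : Finset.Icc 1 (N - 1) = insert 1 (Finset.Icc 2 (N - 1)) := by
    ext x
    simp only [Finset.mem_Icc, Finset.mem_insert]
    omega
  have hn : (1 : ℕ) ∉ Finset.Icc 2 (N - 1) := by simp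
  have hA : (∑ i ∈ Finset.Icc 2 N,
      (1 - q ^ lam i * (q ^ lam (i - 1))⁻¹) * shiftOp i 1 (lamOp q 1 f) lam) =
      q ^ lam 1 * ∑ i ∈ Finset.Icc 2 N,
        (1 - q ^ lam i * (q ^ lam (i - 1))⁻¹) * shiftOp i 1 f lam := by
    rw [Finset.mul_sum]
    refine Finset.sum_congr rfl fun i hi => ?_
    rw [Finset.mem_Icc] at hi
    rw [h1 i 1 (by omega)]
    ring
  have hB : (∑ i ∈ Finset.Icc 2 (N - 1),
      (1 - q ^ lam (i + 1) * (q ^ lam i)⁻¹) * shiftOp i (-1) (lamOp q 1 f) lam) =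
      q ^ lam 1 * ∑ i ∈ Finset.Icc 2 (N - 1),
        (1 - q ^ lam (i + 1) * (q ^ lam i)⁻¹) * shiftOp i (-1) f lam := by
    rw [Finset.mul_sum]
    refine Finset.sum_congr rfl fun i hi => ?_
    rw [Finset.mem_Icc] at hi
    rw [h1 i (-1) (by omega)]
    ring
  have hL : lamOp q 1 (todaC N q f) lam = q ^ lam 1 * todaC N q f lam := rfl
  have hc : q ^ lam 1 * (q ^ lam 1)⁻¹ = 1 := mul_inv_cancel₀ (zpow_ne_zero _ hq)
  rw [hL]
  unfold todaC
  rw [hs, Finset.sum_insert hn, Finset.sum_insert hn, hA, hB, h1 N (-1) (by omega), h2 1, h2 (-1),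
    zpow_one, zpow_neg_one]
  norm_num only
  linear_combination (-(q⁻¹ - 1) * q ^ lam 2 * shiftOp 1 (-1) f lam) * hc
end
end
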